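/- arXiv:2510.01572 — 3 statements merged into one kernel-verified Lean document; each statement's English description precedes it below -/
import Mathlib

section
/- For all integers α ≥ 0 and n ≥ 0, a_{20}(3^{2α+3} n + (198·3^{2α} − 6)/8) ≡ 0 (mod 3). (Note that 198·3^{2α} ≡ 6 (mod 8), so the indicated quotient is an integer.) -/
/-- The set of `k`-colored-odd partitions of `n`: multisets of pairs `(m, c)` with
`m` a positive integer and `c ∈ {1, …, k}`, such that `c = 1` whenever `m` is even,
and the parts `m` sum (with multiplicity) to `n`. -/
def coloredOddPartitions (k n : ℕ) : Set (Multiset (ℕ × ℕ)) :=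
  {s | (∀ p ∈ s, 0 < p.1 ∧ 1 ≤ p.2 ∧ p.2 ≤ k ∧ (Even p.1 → p.2 = 1)) ∧
    (s.map Prod.fst).sum = n}

/-- `a k n` is the number of `k`-colored-odd partitions of `n`. -/
noncomputable def a (k n : ℕ) : ℕ := Nat.card (coloredOddPartitions k n)

open PowerSeries Finset

namespace ColOdd

abbrev R := PowerSeries (ZMod 3)

instance : Fact (Nat.Prime 3) := ⟨by norm_num⟩

/-- Reduction modulo `X ^ N`. -/
noncomputable abbrev red (N : ℕ) : R →+* R ⧸ (Ideal.span {(X : R) ^ N}) :=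
  Ideal.Quotient.mk (Ideal.span {(X : R) ^ N})

lemma red_eq_iff {N : ℕ} {P Q : R} :
    red N P = red N Q ↔ ∀ m < N, coeff m P = coeff m Q := by
  rw [Ideal.Quotient.eq, Ideal.mem_span_singleton, X_pow_dvd_iff]
  simp only [map_sub, sub_eq_zero]

lemma eq_of_red {P Q : R} (h : ∀ N, red N P = red N Q) : P = Q := by
  ext m
  exact red_eq_iff.1 (h (m + 1)) m (Nat.lt_succ_self m)

lemma red_X_pow {N e : ℕ} (h : N ≤ e) : red N ((X : R) ^ e) = 0 := by
  rw [Ideal.Quotient.eq_zero_iff_mem, Ideal.mem_span_singleton]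
  exact pow_dvd_pow _ h

/-- Existence of infinite products. -/
lemma exists_prod (u : ℕ → R) (hu : ∀ i, (X : R) ^ (i + 1) ∣ u i) :
    ∃ P : R, ∀ N n, N ≤ n → red N (∏ i ∈ range n, (1 + u i)) = red N P := by
  have key : ∀ N n, N ≤ n → red N (∏ i ∈ range n, (1 + u i)) =
      red N (∏ i ∈ range N, (1 + u i)) := by
    intro N n h
    induction n, h using Nat.le_induction with
    | base => rfl
    | succ n hn ih =>
      rw [prod_range_succ, map_mul, ih, map_add, map_one]
      have : red N (u n) = 0 := by
        rw [Ideal.Quotient.eq_zero_iff_mem, Ideal.mem_span_singleton]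
        exact (pow_dvd_pow _ (by omega)).trans (hu n)
      rw [this, add_zero, mul_one]
  refine ⟨PowerSeries.mk fun m => coeff m (∏ i ∈ range (m + 1), (1 + u i)), ?_⟩
  intro N n h
  rw [red_eq_iff]
  intro m hm
  rw [coeff_mk]
  exact red_eq_iff.1 (key (m + 1) n (by omega)) m (Nat.lt_succ_self m)

/-- q-binomial coefficients. -/
def qb {A : Type*} [CommRing A] (Q : A) : ℕ → ℕ → A
  | _, 0 => 1
  | 0, _ + 1 => 0
  | n + 1, k + 1 => qb Q n k + Q ^ (k + 1) * qb Q n (k + 1)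

lemma qb_zero {A : Type*} [CommRing A] (Q : A) (n : ℕ) : qb Q n 0 = 1 := by
  cases n <;> rfl

lemma qb_lt {A : Type*} [CommRing A] (Q : A) (n : ℕ) : ∀ k, n < k → qb Q n k = 0 := by
  induction n with
  | zero => intro k hk; obtain ⟨k, rfl⟩ := Nat.exists_eq_succ_of_ne_zero hk.ne'; rfl
  | succ n ih =>
    intro k hk
    obtain ⟨k, rfl⟩ := Nat.exists_eq_succ_of_ne_zero (by omega : k ≠ 0)
    rw [Nat.succ_eq_add_one, qb, ih k (by omega), ih (k + 1) (by omega)]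
    ring

lemma cauchy {A : Type*} [CommRing A] (Q y : A) (m : ℕ) : ∀ z : A,
    ∏ i ∈ range m, (y + z * Q ^ i) =
      ∑ j ∈ range (m + 1), qb Q m j * Q ^ (j.choose 2) * z ^ j * y ^ (m - j) := by
  induction m with
  | zero => intro z; simp [qb]
  | succ m ih =>
    intro z
    have h1 : ∏ i ∈ range (m + 1), (y + z * Q ^ i) =
        (y + z) * ∏ i ∈ range m, (y + (z * Q) * Q ^ i) := by
      rw [prod_range_succ']
      simp only [pow_succ, pow_zero, mul_one]
      rw [mul_comm]
      congr 1
      apply prod_congr rfl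
      intros; ring
    rw [h1, ih, add_mul, mul_sum, mul_sum]
    rw [sum_range_succ' _ (m + 1)]
    have h2 : ∑ j ∈ range (m + 1),
        qb Q (m + 1) (j + 1) * Q ^ ((j + 1).choose 2) * z ^ (j + 1) * y ^ (m + 1 - (j + 1)) =
        ∑ j ∈ range (m + 1), z * (qb Q m j * Q ^ (j.choose 2) * (z * Q) ^ j * y ^ (m - j)) +
        ∑ j ∈ range (m + 1), qb Q m (j + 1) * Q ^ ((j + 1).choose 2) * (z * Q) ^ (j + 1) *
          y ^ (m - j) := by
      rw [← sum_add_distrib]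
      apply sum_congr rfl
      intro j _
      rw [qb, Nat.choose_succ_succ' j 1, Nat.choose_one_right, Nat.add_sub_add_right]
      ring
    rw [h2, sum_range_succ (fun j => qb Q m (j + 1) * _ * _ * _) m, qb_lt Q m (m + 1) (by omega)]
    rw [sum_range_succ' (fun j => y * _) m]
    have h3 : ∑ j ∈ range m, y * (qb Q m (j + 1) * Q ^ ((j + 1).choose 2) * (z * Q) ^ (j + 1) *
          y ^ (m - (j + 1))) = ∑ j ∈ range m, qb Q m (j + 1) * Q ^ ((j + 1).choose 2) *
          (z * Q) ^ (j + 1) * y ^ (m - j) := by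
      apply sum_congr rfl
      intro j hj
      have : m - j = (m - (j + 1)) + 1 := by have := mem_range.1 hj; omega
      rw [this, pow_succ]; ring
    rw [h3]
    simp [qb_zero, pow_succ]
    ring

lemma qb_fact {A : Type*} [CommRing A] (Q : A) (n : ℕ) : ∀ k ≤ n,
    qb Q n k * (∏ i ∈ range k, (1 - Q ^ (i + 1))) * (∏ i ∈ range (n - k), (1 - Q ^ (i + 1))) =
      ∏ i ∈ range n, (1 - Q ^ (i + 1)) := by
  induction n with
  | zero => intro k hk; obtain rfl : k = 0 := by omega
            simp [qb]
  | succ n ih =>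
    intro k hk
    cases k with
    | zero => simp [qb_zero]
    | succ k =>
      have h1 := ih k (by omega)
      rw [qb, Nat.add_sub_add_right, prod_range_succ _ k, prod_range_succ _ n]
      rcases Nat.lt_or_ge k n with h | h
      · have h2 := ih (k + 1) (by omega)
        have e : n - k = (n - (k + 1)) + 1 := by omega
        rw [prod_range_succ _ k] at h2
        have e2 : n + 1 = (k + 1) + (n - (k + 1) + 1) := by omega
        have e3 : Q ^ (n + 1) = Q ^ (k + 1) * Q ^ (n - (k + 1) + 1) := by
          rw [← pow_add, ← e2]
        rw [e3]
        rw [e, prod_range_succ] at h1 ⊢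
        linear_combination (1 - Q ^ (k + 1)) * h1 + Q ^ (k + 1) * (1 - Q ^ (n - (k + 1) + 1)) * h2
      · obtain rfl : k = n := by omega
        rw [qb_lt Q k (k + 1) (by omega)]
        linear_combination (1 - Q ^ (k + 1)) * h1

lemma two_choose (k : ℕ) : (k + 1).choose 2 = k + k.choose 2 := by
  rw [Nat.choose_succ_succ' k 1, Nat.choose_one_right]

lemma choose_add (n k : ℕ) : (n + k).choose 2 = n.choose 2 + k.choose 2 + n * k := by
  induction k with
  | zero => simp
  | succ k ih => rw [← add_assoc, two_choose, two_choose, ih]; ring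

lemma finite_jtp (c s t n : ℕ) (hc : s + t = c) :
    ∏ i ∈ range n, ((1 + (X : R) ^ (c * i + s)) * (1 + (X : R) ^ (c * i + t))) =
      ∑ k ∈ range (n + 1), qb ((X : R) ^ c) (2 * n) (n + k) * X ^ (c * k.choose 2 + s * k) +
      ∑ k ∈ range n, qb ((X : R) ^ c) (2 * n) (n - 1 - k) *
        X ^ (c * (k + 1).choose 2 + t * (k + 1)) := by
  have hX : (X : R) ^ (s * n + c * n.choose 2 + c * n * n) ≠ 0 := pow_ne_zero _ X_ne_zero
  apply mul_left_cancel₀ hX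
  have h := cauchy ((X : R) ^ c) (X ^ (c * n)) (n + n) (X ^ s)
  have hL : ∏ i ∈ range (n + n), ((X : R) ^ (c * n) + X ^ s * (X ^ c) ^ i) =
      X ^ (s * n + c * n.choose 2 + c * n * n) *
      ∏ i ∈ range n, ((1 + (X : R) ^ (c * i + s)) * (1 + (X : R) ^ (c * i + t))) := by
    rw [prod_range_add, ← prod_range_reflect, prod_mul_distrib]
    have h1 : ∏ j ∈ range n, ((X : R) ^ (c * n) + X ^ s * (X ^ c) ^ (n - 1 - j)) =
        X ^ (s * n + c * n.choose 2) * ∏ j ∈ range n, (1 + (X : R) ^ (c * j + t)) := by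
      have h2 : ∏ j ∈ range n, ((X : R) ^ s * (X ^ c) ^ (n - 1 - j)) =
          X ^ (s * n + c * n.choose 2) := by
        rw [prod_range_reflect (fun j => (X : R) ^ s * (X ^ c) ^ j)]
        clear h hX
        induction n with
        | zero => simp
        | succ n ih => rw [prod_range_succ, ih, two_choose]; ring
      rw [← h2, ← prod_mul_distrib]
      apply prod_congr rfl
      intro j hj
      have hj := mem_range.1 hj
      obtain ⟨d, rfl⟩ : ∃ d, n = j + 1 + d := ⟨n - (j + 1), by omega⟩
      have : j + 1 + d - 1 - j = d := by omega
      rw [this, ← hc]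
      ring
    have h3 : ∏ x ∈ range n, ((X : R) ^ (c * n) + X ^ s * (X ^ c) ^ (n + x)) =
        X ^ (c * n * n) * ∏ j ∈ range n, (1 + (X : R) ^ (c * j + s)) := by
      have : (X : R) ^ (c * n * n) = ∏ j ∈ range n, X ^ (c * n) := by simp [pow_mul]
      rw [this, ← prod_mul_distrib]
      apply prod_congr rfl
      intros; ring
    rw [h1, h3, pow_add _ _ (c * n * n)]
    ring
  rw [← hL, h, show n + n + 1 = n + (n + 1) by ring, sum_range_add, ← sum_range_reflect, mul_add,
    add_comm, mul_sum, mul_sum, ← two_mul]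
  congr 1
  · apply sum_congr rfl
    intro k hk
    have hk := mem_range.1 hk
    obtain ⟨d, rfl⟩ : ∃ d, n = k + d := ⟨n - k, by omega⟩
    have : 2 * (k + d) - (k + d + k) = d := by omega
    rw [this, choose_add (k + d) k]
    ring
  · apply sum_congr rfl
    intro k hk
    have hk := mem_range.1 hk
    obtain ⟨d, rfl⟩ : ∃ d, n = d + (k + 1) := ⟨n - (k + 1), by omega⟩
    have e1 : d + (k + 1) - 1 - k = d := by omega
    have e2 : 2 * (d + (k + 1)) - d = d + 2 * (k + 1) := by omega
    rw [e1, e2, choose_add d (k + 1)]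
    have hC : 2 * (k + 1).choose 2 = (k + 1) * k := by
      clear * -
      induction k with
      | zero => simp
      | succ k ih => rw [two_choose, mul_add, ih]; ring
    generalize (k + 1).choose 2 = C at hC
    have he : c * d.choose 2 + s * d + c * (d + (k + 1)) * (d + 2 * (k + 1)) =
        s * (d + (k + 1)) + c * (d.choose 2 + C + d * (k + 1)) +
        c * (d + (k + 1)) * (d + (k + 1)) + (c * C + t * (k + 1)) := by
      subst hc
      zify at hC ⊢
      linear_combination (-(s + t : ℤ)) * hC
    calc _ = qb ((X : R) ^ c) (2 * (d + (k + 1))) d *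
          X ^ (c * d.choose 2 + s * d + c * (d + (k + 1)) * (d + 2 * (k + 1))) := by ring
      _ = _ := by rw [he]; ring

lemma jtp (c s t N n : ℕ) (hc : s + t = c) (hc0 : 0 < c) (hn : 2 * N + 4 ≤ n) (E : R)
    (hE : ∀ n, N ≤ n → red N (∏ i ∈ range n, (1 - ((X : R) ^ c) ^ (i + 1))) = red N E)
    (hu : IsUnit (red N E)) :
    red N (E * ∏ i ∈ range n, ((1 + (X : R) ^ (c * i + s)) * (1 + (X : R) ^ (c * i + t)))) =
    red N (∑ k ∈ range n, ((X : R) ^ (c * k.choose 2 + s * k) +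
      X ^ (c * (k + 1).choose 2 + t * (k + 1)))) := by
  have hch : ∀ k r, N + 3 ≤ k → N ≤ c * k.choose 2 + r := by
    intro k r hk
    obtain ⟨d, rfl⟩ : ∃ d, k = d + 1 := ⟨k - 1, by omega⟩
    rw [two_choose]
    nlinarith [Nat.zero_le (d.choose 2), Nat.zero_le (c * d.choose 2)]
  have hq : ∀ j, N ≤ j → N + j ≤ 2 * n → red N E * red N (qb ((X : R) ^ c) (2 * n) j) = 1 := by
    intro j h1 h2
    have := congrArg (red N) (qb_fact ((X : R) ^ c) (2 * n) j (by omega))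
    rw [map_mul, map_mul, hE _ h1, hE _ (by omega), hE _ (by omega)] at this
    apply hu.mul_left_cancel
    linear_combination this
  rw [finite_jtp c s t n hc, sum_add_distrib, mul_add, map_add, map_add, mul_sum, mul_sum,
    map_sum, map_sum, map_sum, map_sum, sum_range_succ]
  have hz : red N ((X : R) ^ (c * n.choose 2 + s * n)) = 0 := red_X_pow (hch n _ (by omega))
  rw [map_mul (red N) E (_ * _), map_mul (red N) _ (X ^ _), hz, mul_zero, mul_zero, add_zero]
  congr 1
  · apply sum_congr rfl
    intro k hk
    have hk := mem_range.1 hk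
    rw [map_mul, map_mul, ← mul_assoc]
    rcases Nat.lt_or_ge k (N + 3) with h | h
    · rw [hq _ (by omega) (by omega), one_mul]
    · rw [red_X_pow (hch k _ h), mul_zero]
  · apply sum_congr rfl
    intro k hk
    have hk := mem_range.1 hk
    rw [map_mul, map_mul, ← mul_assoc]
    rcases Nat.lt_or_ge k (N + 3) with h | h
    · rw [hq _ (by omega) (by omega), one_mul]
    · rw [red_X_pow (hch (k + 1) _ (by omega)), mul_zero]

instance : CharP R 3 :=
  charP_of_injective_algebraMap (R := ZMod 3) (A := R) C_injective 3

lemma cube_prod (n : ℕ) (e : ℕ → ℕ) (σ : ZMod 3) :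
    (∏ i ∈ range n, (1 + C σ * (X : R) ^ (e i))) ^ 3 =
      ∏ i ∈ range n, (1 + C σ * (X : R) ^ (3 * e i)) := by
  rw [← prod_pow]
  apply prod_congr rfl
  intro i _
  rw [add_pow_char, mul_pow, ← map_pow, ZMod.pow_card, one_pow, ← pow_mul, mul_comm 3]

/-- Abstract properties of the two infinite products. -/
structure IsPair (f g : R) : Prop where
  hf : ∀ N n, N ≤ n → red N (∏ i ∈ range n, (1 - (X : R) ^ (i + 1))) = red N f
  hg : ∀ N n, N ≤ n → red N (∏ i ∈ range n, (1 + (X : R) ^ (i + 1))) = red N g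
  uf : IsUnit f
  ug : IsUnit g

lemma exists_pair : ∃ f g : R, IsPair f g := by
  obtain ⟨f, hf⟩ := exists_prod (fun i => -(X : R) ^ (i + 1)) (fun i => (dvd_neg.2 dvd_rfl))
  obtain ⟨g, hg⟩ := exists_prod (fun i => (X : R) ^ (i + 1)) (fun i => dvd_rfl)
  have hunit : ∀ (P : R) (u : ℕ → R),
      red 1 (∏ i ∈ range 1, (1 + X * u i)) = red 1 P → IsUnit P := by
    intro P u h
    rw [isUnit_iff_constantCoeff, ← coeff_zero_eq_constantCoeff_apply,
      ← red_eq_iff.1 h 0 one_pos]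
    simp
  refine ⟨f, g, ⟨by simpa [sub_eq_add_neg] using hf, hg, ?_, ?_⟩⟩
  · exact hunit f (fun i => - X ^ i) (by simpa [pow_succ'] using hf 1 1 le_rfl)
  · exact hunit g (fun i => X ^ i) (by simpa [pow_succ'] using hg 1 1 le_rfl)

lemma psi_sum {f g : R} (h : IsPair f g) (N n : ℕ) (hn : 2 * N + 4 ≤ n) :
    red N (f * g ^ 2) = red N (∑ k ∈ range n, (X : R) ^ ((k + 1).choose 2)) := by
  have J := jtp 1 1 0 N n rfl one_pos hn f (by simpa using h.hf N) (h.uf.map _)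
  obtain ⟨m, rfl⟩ : ∃ m, n = m + 1 := ⟨n - 1, by omega⟩
  have e1 : ∏ i ∈ range (m + 1), ((1 + (X : R) ^ (1 * i + 1)) * (1 + (X : R) ^ (1 * i + 0))) =
      (∏ i ∈ range (m + 1), (1 + (X : R) ^ (i + 1))) *
      (2 * ∏ i ∈ range m, (1 + (X : R) ^ (i + 1))) := by
    rw [prod_mul_distrib]
    congr 1
    · simp
    · rw [prod_range_succ']
      simp
      ring
  rw [e1, map_mul, map_mul, map_mul, h.hg N _ (by omega), h.hg N _ (by omega)] at J
  have e2 : ∑ k ∈ range (m + 1), ((X : R) ^ (1 * k.choose 2 + 1 * k) +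
      X ^ (1 * (k + 1).choose 2 + 0 * (k + 1))) =
      2 * ∑ k ∈ range (m + 1), (X : R) ^ ((k + 1).choose 2) := by
    rw [mul_sum]
    apply sum_congr rfl
    intro k _
    rw [two_choose]; ring
  rw [e2, map_mul] at J
  have h2 : (red N 2) * (red N 2) = 1 := by
    rw [← map_mul, ← map_one (red N)]
    congr 1
    have : (3 : R) = 0 := CharP.cast_eq_zero R 3
    linear_combination this
  have J' := congrArg (fun x => red N 2 * x) J
  rw [map_mul, map_pow]
  linear_combination J' - (red N f * red N g ^ 2 -
    red N (∑ k ∈ range (m + 1), (X : R) ^ ((k + 1).choose 2))) * h2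

lemma A_sum {f g A : R} (h : IsPair f g) (hA : A * g ^ 2 = f ^ 3) (N n : ℕ)
    (hn : 2 * N + 4 ≤ n) :
    red N A = red N (∑ k ∈ range n, ((X : R) ^ (3 * k.choose 2 + 2 * k) +
      X ^ (3 * (k + 1).choose 2 + (k + 1)))) := by
  have hE : ∀ n, N ≤ n → red N (∏ i ∈ range n, (1 - ((X : R) ^ 3) ^ (i + 1))) = red N (f ^ 3) := by
    intro n hn
    rw [map_pow, ← h.hf N n hn, ← map_pow]
    have := cube_prod n (fun i => i + 1) (-1)
    simp only [map_neg, map_one, neg_mul, one_mul, ← sub_eq_add_neg] at this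
    rw [this]
    simp only [pow_mul]
  have J := jtp 3 2 1 N n rfl (by norm_num) hn (f ^ 3) hE ((h.uf.pow 3).map _)
  simp only [one_mul] at J
  rw [← J]
  have hG : (∏ i ∈ range n, ((1 + (X : R) ^ (3 * i + 2)) * (1 + (X : R) ^ (3 * i + 1)))) *
      (∏ i ∈ range n, (1 + (X : R) ^ (i + 1))) ^ 3 =
      ∏ i ∈ range (3 * n), (1 + (X : R) ^ (i + 1)) := by
    have := cube_prod n (fun i => i + 1) 1
    simp only [map_one, one_mul] at this
    rw [this]
    clear * -
    induction n with
    | zero => simp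
    | succ n ih =>
      rw [show 3 * (n + 1) = 3 * n + 1 + 1 + 1 by ring, prod_range_succ, prod_range_succ,
        prod_range_succ, prod_range_succ, prod_range_succ, ← ih]
      ring
  have hG' := congrArg (red N) hG
  rw [map_mul, map_pow, h.hg N n (by omega), h.hg N _ (by omega)] at hG'
  have hA' := congrArg (red N) hA
  rw [map_mul, map_pow, map_pow] at hA'
  rw [map_mul, map_pow]
  have ug : IsUnit (red N g) := h.ug.map _
  apply (ug.pow 3).mul_left_cancel
  linear_combination red N g * hA' - red N f ^ 3 * hG'

lemma psi_dissect {f g A : R} (h : IsPair f g) (hA : A * g ^ 2 = f ^ 3) :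
    f * g ^ 2 = A ^ 3 + X * (f * g ^ 2) ^ 9 := by
  apply eq_of_red
  intro N
  conv_lhs => rw [psi_sum h N (3 * (2 * N + 4)) (by omega)]
  rw [map_add, map_mul (red N) X, map_pow, map_pow _ (f * g ^ 2), A_sum h hA N (2 * N + 4) le_rfl,
    psi_sum h N (2 * N + 4) le_rfl,
    ← map_pow, ← map_pow, ← map_mul, ← map_add]
  congr 1
  generalize 2 * N + 4 = n
  rw [show 9 = 3 * 3 by rfl, pow_mul, sum_pow_char, sum_pow_char, sum_pow_char]
  induction n with
  | zero => simp
  | succ n ih =>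
    rw [show 3 * (n + 1) = 3 * n + 1 + 1 + 1 by ring, sum_range_succ, sum_range_succ,
      sum_range_succ, ih, sum_range_succ, sum_range_succ, add_pow_char]
    have hC : 2 * n.choose 2 + n = n * n := by
      clear * -
      induction n with
      | zero => simp
      | succ k ih => rw [two_choose, mul_add]; linarith
    have c3 : (3 * n).choose 2 = 9 * n.choose 2 + 3 * n := by
      rw [show 3 * n = n + n + n by ring, choose_add, choose_add]
      nlinarith
    simp only [two_choose, c3]
    ring

lemma coeff_cube (P : R) (n r j : ℕ) (hr : r < 3) (hj : j < 3) :
    coeff (3 * n + r) (X ^ j * P ^ 3) = if r = j then coeff n P else 0 := by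
  have hexp : P ^ 3 = PowerSeries.expand 3 (by norm_num) P := by
    have := MvPowerSeries.map_frobenius_expand (σ := Unit) (R := ZMod 3) 3 (by norm_num) (f := P)
    rw [← this, ZMod.frobenius_zmod]
    rfl
  rw [hexp, coeff_X_pow_mul', coeff_expand]
  by_cases hrj : r = j
  · subst hrj
    simp
  · rw [if_neg hrj]
    split_ifs <;> first | rfl | omega

lemma coeff_three (P Q₀ Q₁ Q₂ Q : R) (hQ : Q = Q₀ ^ 3 + X * Q₁ ^ 3 + X ^ 2 * Q₂ ^ 3) (n : ℕ) :
    coeff (3 * n) (P ^ 3 * Q) = coeff n (P * Q₀) ∧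
    coeff (3 * n + 2) (P ^ 3 * Q) = coeff n (P * Q₂) := by
  have : P ^ 3 * Q = X ^ 0 * (P * Q₀) ^ 3 + X ^ 1 * (P * Q₁) ^ 3 + X ^ 2 * (P * Q₂) ^ 3 := by
    rw [hQ]; ring
  rw [this]
  constructor
  · have := fun P j hj => coeff_cube P n 0 j (by norm_num) hj
    simp only [add_zero] at this
    rw [map_add, map_add, this _ 0 (by norm_num), this _ 1 (by norm_num), this _ 2 (by norm_num)]
    simp
  · have := fun P j hj => coeff_cube P n 2 j (by norm_num) hj
    rw [map_add, map_add, this _ 0 (by norm_num), this _ 1 (by norm_num), this _ 2 (by norm_num)]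
    simp

lemma alg1 {S : Type*} [CommRing S] (f g f' F ψ : S) (hf' : f * f' = 1)
    (hF : F * f = g ^ 19) (hψ : ψ = f * g ^ 2) : F = (g ^ 5 * f') ^ 3 * ψ ^ 2 := by
  have : f ^ 3 * f' ^ 3 = 1 := by rw [← mul_pow, hf', one_pow]
  calc F = F * f * f' := by rw [mul_assoc, hf', mul_one]
    _ = g ^ 19 * f' * (f * f') ^ 2 := by rw [hF, hf']; ring
    _ = _ := by rw [hψ]; ring

lemma alg2 {S : Type*} [CommRing S] (f g f' A : S) (hf' : f * f' = 1)
    (hA : A * g ^ 2 = f ^ 3) : g ^ 5 * f' * A ^ 2 = f ^ 5 * g := by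
  calc g ^ 5 * f' * A ^ 2 = g * f' * (A * g ^ 2) ^ 2 := by ring
    _ = g * f ^ 5 * (f * f') := by rw [hA]; ring
    _ = _ := by rw [hf']; ring

lemma alg3 {S : Type*} [CommRing S] (f g g' ψ : S) (hg' : g * g' = 1) (hψ : ψ = f * g ^ 2) :
    f ^ 5 * g = (f * g') ^ 3 * ψ ^ 2 := by
  calc f ^ 5 * g = f ^ 5 * g * (g * g') ^ 3 := by rw [hg']; ring
    _ = _ := by rw [hψ]; ring

lemma alg4 {S : Type*} [CommRing S] (f g g' ψ : S) (hg' : g * g' = 1) (hψ : ψ = f * g ^ 2) :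
    f * g' * ψ ^ 6 = (f ^ 2 * g ^ 3) ^ 3 * ψ := by
  calc f * g' * ψ ^ 6 = f ^ 7 * g ^ 11 * (g * g') := by rw [hψ]; ring
    _ = _ := by rw [hg', hψ]; ring

lemma alg5 {S : Type*} [CommRing S] (f g A : S) (hA : A * g ^ 2 = f ^ 3) :
    f ^ 2 * g ^ 3 * A = f ^ 5 * g := by
  linear_combination f ^ 2 * g * hA

lemma final {f g : R} (h : IsPair f g) (F : R) (hF : F * f = g ^ 19) (α n : ℕ) :
    coeff (3 * (9 ^ (α + 1) * n + (33 * 9 ^ α - 1) / 4)) F = 0 := by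
  obtain ⟨f', hf'⟩ := h.uf.exists_right_inv
  obtain ⟨g', hg'⟩ := h.ug.exists_right_inv
  obtain ⟨A, hA⟩ : ∃ A, A * g ^ 2 = f ^ 3 := ⟨f ^ 3 * g' ^ 2, by
    rw [mul_assoc, ← mul_pow, mul_comm g', hg']; ring⟩
  have hψ := psi_dissect h hA
  obtain ⟨ψ, hψd⟩ : ∃ ψ, ψ = f * g ^ 2 := ⟨_, rfl⟩
  rw [← hψd] at hψ
  have hψ2 : ψ ^ 2 = (A ^ 2) ^ 3 + X * (2 * A * ψ ^ 3) ^ 3 + X ^ 2 * (ψ ^ 6) ^ 3 := by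
    have h3 : (3 : R) = 0 := CharP.cast_eq_zero R 3
    conv_lhs => rw [hψ]
    linear_combination (-2 * X * A ^ 3 * ψ ^ 9) * h3
  have hψ1 : ψ = A ^ 3 + X * (ψ ^ 3) ^ 3 + X ^ 2 * 0 ^ 3 := by
    conv_lhs => rw [hψ]
    ring
  have s1 : ∀ m, coeff (3 * m) F = coeff m (f ^ 5 * g) := by
    intro m
    have e : F = (g ^ 5 * f') ^ 3 * ψ ^ 2 := alg1 f g f' F ψ hf' hF hψd
    rw [e, (coeff_three _ _ _ _ _ hψ2 m).1]
    rw [alg2 f g f' A hf' hA]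
  have s2 : ∀ m, coeff (3 * m + 2) (f ^ 5 * g) = coeff m ((f ^ 2 * g ^ 3) ^ 3 * ψ) := by
    intro m
    have e : f ^ 5 * g = (f * g') ^ 3 * ψ ^ 2 := alg3 f g g' ψ hg' hψd
    rw [e, (coeff_three _ _ _ _ _ hψ2 m).2]
    rw [alg4 f g g' ψ hg' hψd]
  have s3 : ∀ m, coeff (9 * m + 8) (f ^ 5 * g) = 0 := by
    intro m
    rw [show 9 * m + 8 = 3 * (3 * m + 2) + 2 by ring, s2, (coeff_three _ _ _ _ _ hψ1 m).2]
    simp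
  have s4 : ∀ m, coeff (9 * m + 2) (f ^ 5 * g) = coeff m (f ^ 5 * g) := by
    intro m
    rw [show 9 * m + 2 = 3 * (3 * m) + 2 by ring, s2, (coeff_three _ _ _ _ _ hψ1 m).1]
    rw [alg5 f g A hA]
  rw [s1]
  induction α with
  | zero => simpa using s3 n
  | succ α ih =>
    rw [← ih, ← s4 (9 ^ (α + 1) * n + (33 * 9 ^ α - 1) / 4)]
    have h9 : 9 ^ α % 4 = 1 := by simp [Nat.pow_mod]
    have : (33 * 9 ^ (α + 1) - 1) / 4 = 9 * ((33 * 9 ^ α - 1) / 4) + 2 := by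
      rw [pow_succ]; omega
    have e : 9 ^ (α + 1 + 1) * n + (33 * 9 ^ (α + 1) - 1) / 4 =
        9 * (9 ^ (α + 1) * n + (33 * 9 ^ α - 1) / 4) + 2 := by
      rw [this]
      ring
    rw [e]

/-- The geometric series `1 / (1 - X ^ m)`. -/
noncomputable def geo (m : ℕ) : R := PowerSeries.mk fun j => if m ∣ j then 1 else 0

lemma geo_mul (m : ℕ) (hm : 0 < m) : geo m * (1 - X ^ m) = 1 := by
  ext j
  rw [mul_sub, mul_one, map_sub, coeff_mul_X_pow', geo, coeff_mk, coeff_one]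
  rcases Nat.lt_or_ge j m with h | h
  · rw [if_neg (by omega : ¬ m ≤ j), sub_zero]
    by_cases hj : j = 0
    · simp [hj]
    · rw [if_neg hj, if_neg (Nat.not_dvd_of_pos_of_lt (by omega) h)]
  · rw [if_pos h, coeff_mk, if_neg (by omega : ¬ j = 0)]
    have : m ∣ j - m ↔ m ∣ j := (Nat.dvd_sub_iff_left h dvd_rfl)
    simp [this]

lemma count_gen {ι : Type*} [DecidableEq ι] (S : Finset ι) (w : ι → ℕ) (hw : ∀ p ∈ S, 0 < w p)
    (n : ℕ) :
    ((Nat.card {s : Multiset ι | (∀ p ∈ s, p ∈ S) ∧ (s.map w).sum = n} : ℕ) : ZMod 3) =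
      coeff n (∏ p ∈ S, geo (w p)) := by
  rw [coeff_prod]
  let T := (finsuppAntidiag S n).filter (fun l => ∀ p ∈ S, w p ∣ l p)
  have h1 : ∑ l ∈ finsuppAntidiag S n, ∏ p ∈ S, coeff (l p) (geo (w p)) = (T.card : ZMod 3) := by
    rw [card_filter, Nat.cast_sum]
    apply sum_congr rfl
    intro l _
    simp only [geo, coeff_mk]
    rw [prod_ite_zero]
    simp
  rw [h1]
  congr 1
  let φ : (ι →₀ ℕ) → Multiset ι := fun l => ∑ p ∈ S, Multiset.replicate (l p / w p) p
  have hcount : ∀ l q, (φ l).count q = if q ∈ S then l q / w q else 0 := by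
    intro l q
    simp only [φ]
    rw [Multiset.count_sum']
    simp [Multiset.count_replicate]
  have himg : {s : Multiset ι | (∀ p ∈ s, p ∈ S) ∧ (s.map w).sum = n} = φ '' (T : Set (ι →₀ ℕ)) := by
    ext s
    constructor
    · rintro ⟨hs, hn⟩
      refine ⟨Finsupp.onFinset S (fun p => w p * s.count p) ?_, ?_, ?_⟩
      · intro p hp
        apply hs
        rw [← Multiset.count_ne_zero]
        exact fun h => hp (by simp [h])
      · simp only [T, coe_filter, Set.mem_ofPred_eq, mem_finsuppAntidiag]
        refine ⟨⟨?_, Finsupp.support_onFinset_subset⟩, fun p _ => by simp⟩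
        rw [← hn, Finset.sum_multiset_map_count]
        simp only [Finsupp.onFinset_apply, smul_eq_mul]
        symm
        have : s.toFinset ⊆ S := fun p hp => hs p (Multiset.mem_toFinset.1 hp)
        rw [sum_subset this]
        · exact sum_congr rfl fun p _ => mul_comm _ _
        · intro p _ hp
          rw [Multiset.mem_toFinset] at hp
          simp [Multiset.count_eq_zero_of_notMem hp]
      · ext q
        rw [hcount]
        split_ifs with hq
        · simp [Nat.mul_div_cancel_left _ (hw q hq)]
        · exact (Multiset.count_eq_zero_of_notMem fun h => hq (hs q h)).symm
    · rintro ⟨l, hl, rfl⟩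
      simp only [T, coe_filter, Set.mem_ofPred_eq, mem_finsuppAntidiag] at hl
      obtain ⟨⟨hl1, hl2⟩, hl3⟩ := hl
      refine ⟨?_, ?_⟩
      · intro p hp
        by_contra hpS
        rw [← Multiset.count_ne_zero, hcount, if_neg hpS] at hp
        exact hp rfl
      · simp only [φ]
        rw [← Multiset.coe_mapAddMonoidHom, map_sum, ← Multiset.coe_sumAddMonoidHom, map_sum, ← hl1]
        apply sum_congr rfl
        intro p hp
        simp [Nat.div_mul_cancel (hl3 p hp)]
  rw [himg]
  have hinj : Set.InjOn φ (T : Set (ι →₀ ℕ)) := by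
    intro l hl l' hl' h
    simp only [T, coe_filter, Set.mem_ofPred_eq, mem_finsuppAntidiag] at hl hl'
    ext p
    by_cases hp : p ∈ S
    · have := congrArg (Multiset.count p) h
      rw [hcount, hcount, if_pos hp, if_pos hp] at this
      rw [← Nat.div_mul_cancel (hl.2 p hp), this, Nat.div_mul_cancel (hl'.2 p hp)]
    · rw [Finsupp.notMem_support_iff.1 fun h => hp (hl.1.2 h),
        Finsupp.notMem_support_iff.1 fun h => hp (hl'.1.2 h)]
  rw [Nat.card_coe_set_eq, hinj.ncard_image, Set.ncard_coe_finset]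

/-- Parts of size at most `2 * M`. -/
def evens (M : ℕ) : Finset (ℕ × ℕ) := (range M).image fun i => (2 * i + 2, 1)

def odds (M : ℕ) : Finset (ℕ × ℕ) := (range M ×ˢ range 20).image fun i => (2 * i.1 + 1, i.2 + 1)

lemma a_coeff (M n : ℕ) (h : n ≤ 2 * M) :
    ((a 20 n : ℕ) : ZMod 3) = coeff n (∏ p ∈ evens M ∪ odds M, geo p.1) := by
  rw [← count_gen _ Prod.fst]
  · rw [a]
    congr 3
    ext s
    simp only [coloredOddPartitions, Set.mem_ofPred_eq]
    apply and_congr_left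
    intro hs
    apply forall₂_congr
    intro p hp
    have hle : p.1 ≤ n := by
      rw [← hs]
      exact Multiset.le_sum_of_mem (Multiset.mem_map_of_mem _ hp)
    obtain ⟨m, c⟩ := p
    simp only at hle
    simp only [evens, odds, mem_union, mem_image, mem_range, mem_product, Prod.exists,
      Prod.mk.injEq]
    constructor
    · rintro ⟨h1, h2, h3, h4⟩
      rcases Nat.even_or_odd m with he | ho
      · left
        have := h4 he
        obtain ⟨r, rfl⟩ := he
        exact ⟨r - 1, by omega, by omega, by omega⟩
      · right
        obtain ⟨r, rfl⟩ := ho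
        exact ⟨r, c - 1, by omega, by omega, by omega⟩
    · rintro (⟨i, h1, h2, h3⟩ | ⟨i, j, h1, h2, h3⟩)
      · exact ⟨by omega, by omega, by omega, fun _ => h3.symm⟩
      · refine ⟨by omega, by omega, by omega, fun he => ?_⟩
        obtain ⟨r, hr⟩ := he
        omega
  · intro p hp
    simp only [evens, odds, mem_union, mem_image] at hp
    rcases hp with ⟨i, -, rfl⟩ | ⟨i, -, rfl⟩ <;> simp

lemma gen_mul (M : ℕ) :
    (∏ p ∈ evens M ∪ odds M, geo p.1) * ((∏ i ∈ range M, (1 - (X : R) ^ (2 * i + 2))) *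
      (∏ i ∈ range M, (1 - (X : R) ^ (2 * i + 1))) ^ 20) = 1 := by
  rw [prod_union, evens, odds, prod_image, prod_image, prod_product]
  · simp only [prod_const, card_range, prod_pow]
    have e1 : (∏ i ∈ range M, geo (2 * i + 2)) * ∏ i ∈ range M, (1 - (X : R) ^ (2 * i + 2)) = 1 := by
      rw [← prod_mul_distrib]
      exact prod_eq_one fun i _ => geo_mul _ (by omega)
    have e2 : (∏ i ∈ range M, geo (2 * i + 1)) * ∏ i ∈ range M, (1 - (X : R) ^ (2 * i + 1)) = 1 := by
      rw [← prod_mul_distrib]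
      exact prod_eq_one fun i _ => geo_mul _ (by omega)
    rw [mul_mul_mul_comm, e1, ← mul_pow, e2]
    simp
  · rintro ⟨i, j⟩ _ ⟨i', j'⟩ _ h
    simp only [Prod.mk.injEq] at h ⊢
    omega
  · intro i _ j _ h
    simp only [Prod.mk.injEq] at h
    omega
  · rw [disjoint_left]
    intro p hp hp'
    simp only [evens, odds, mem_image] at hp hp'
    obtain ⟨i, -, rfl⟩ := hp
    obtain ⟨j, -, hj⟩ := hp'
    simp only [Prod.mk.injEq] at hj
    omega

lemma alg6 {S : Type*} [CommRing S] (f g e o G : S) (hG : G * (e * o ^ 20) = 1)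
    (h1 : e * o = f) (h2 : e = f * g) (uf : IsUnit f) : G * f = g ^ 19 := by
  have h3 : o * g = 1 := by
    apply uf.mul_left_cancel
    rw [mul_one]
    subst h2
    linear_combination h1
  calc G * f = G * f * (o * g) ^ 20 := by rw [h3]; ring
    _ = g ^ 19 * (G * ((f * g) * o ^ 20)) := by ring
    _ = g ^ 19 := by rw [← h2, hG, mul_one]

lemma gen_F {f g : R} (h : IsPair f g) :
    (PowerSeries.mk fun n => ((a 20 n : ℕ) : ZMod 3)) * f = g ^ 19 := by
  apply eq_of_red
  intro N
  have hF : red N (PowerSeries.mk fun n => ((a 20 n : ℕ) : ZMod 3)) =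
      red N (∏ p ∈ evens N ∪ odds N, geo p.1) := by
    rw [red_eq_iff]
    intro m hm
    rw [coeff_mk, a_coeff N m (by omega)]
  rw [map_mul, hF, map_pow]
  have hG := congrArg (red N) (gen_mul N)
  rw [map_mul, map_mul, map_pow, map_one] at hG
  refine alg6 _ _ _ _ _ hG ?_ ?_ (h.uf.map _)
  · rw [← h.hf N (2 * N) (by omega), ← map_mul]
    congr 1
    clear * -
    induction N with
    | zero => simp
    | succ n ih =>
      rw [show 2 * (n + 1) = 2 * n + 1 + 1 by ring, prod_range_succ, prod_range_succ,
        prod_range_succ, prod_range_succ, ← ih]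
      ring
  · rw [← h.hf N N le_rfl, ← h.hg N N le_rfl, ← map_mul, ← prod_mul_distrib]
    congr 1
    apply prod_congr rfl
    intros
    ring

end ColOdd

theorem stmt5 (α n : ℕ) :
    a 20 (3 ^ (2 * α + 3) * n + (198 * 3 ^ (2 * α) - 6) / 8) ≡ 0 [MOD 3] := by
  obtain ⟨f, g, h⟩ := ColOdd.exists_pair
  have := ColOdd.final h _ (ColOdd.gen_F h) α n
  rw [PowerSeries.coeff_mk] at this
  rw [← ZMod.natCast_eq_natCast_iff, Nat.cast_zero, ← this]
  congr 2
  have h9 : 9 ^ α % 4 = 1 := by simp [Nat.pow_mod]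
  have e1 : 3 ^ (2 * α) = 9 ^ α := by rw [pow_mul]; norm_num
  have e2 : (198 * 9 ^ α - 6) / 8 = 3 * ((33 * 9 ^ α - 1) / 4) := by omega
  rw [pow_add, e1, e2, pow_succ]
  ring
end

section
/- For all integers α ≥ 0 and n ≥ 0, a_{23}(3^{2α+3} n + (207·3^{2α} − 7)/8) ≡ 0 (mod 3). (Note that 207·3^{2α} ≡ 7 (mod 8), so the indicated quotient is an integer.) -/
open PowerSeries Finset

abbrev PS3 := PowerSeries (ZMod 3)

instance fact3 : Fact (Nat.Prime 3) := ⟨Nat.prime_three⟩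

noncomputable def dis (r : ℕ) (f : PS3) : PS3 := PowerSeries.mk fun n => coeff (3 * n + r) f

lemma coeff_dis (r n : ℕ) (f : PS3) : coeff n (dis r f) = coeff (3 * n + r) f := by
  simp [dis]

lemma expand_eq_cube (f : PS3) : PowerSeries.expand 3 (by norm_num) f = f ^ 3 := by
  have h := MvPowerSeries.map_frobenius_expand (σ := Unit) (R := ZMod 3) 3 (by norm_num) (f := f)
  have h2 : frobenius (ZMod 3) 3 = RingHom.id _ := ZMod.frobenius_zmod 3
  rw [h2] at h
  have h3 : (MvPowerSeries.map (RingHom.id (ZMod 3)) : MvPowerSeries Unit (ZMod 3) →+* _) = RingHom.id _ := by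
    exact MvPowerSeries.map_id
  rw [h3] at h
  exact h

lemma coeff_cube (f : PS3) (n : ℕ) : coeff n (f ^ 3) = if 3 ∣ n then coeff (n / 3) f else 0 := by
  rw [← expand_eq_cube, PowerSeries.coeff_expand]

lemma dis_add (r : ℕ) (f g : PS3) : dis r (f + g) = dis r f + dis r g := by
  ext n; simp [coeff_dis]

lemma dis_X_cube (r i : ℕ) (hr : r < 3) (hi : i < 3) (g : PS3) :
    dis r (X ^ i * g ^ 3) = if i = r then g else 0 := by
  ext n
  rw [coeff_dis, PowerSeries.coeff_X_pow_mul', coeff_cube]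
  split_ifs with h1 h2 h3 h3 h3
  · congr 2; omega
  · omega
  · omega
  · simp
  · omega
  · simp

lemma dis_decomp (f : PS3) :
    f = X ^ 0 * (dis 0 f) ^ 3 + X ^ 1 * (dis 1 f) ^ 3 + X ^ 2 * (dis 2 f) ^ 3 := by
  ext n
  rw [map_add, map_add]
  simp only [PowerSeries.coeff_X_pow_mul', coeff_cube, coeff_dis]
  obtain ⟨k, rfl | rfl | rfl⟩ : ∃ k, n = 3 * k ∨ n = 3 * k + 1 ∨ n = 3 * k + 2 := ⟨n / 3, by omega⟩
  · have h1 : ¬ (1 ≤ 3 * k ∧ 3 ∣ 3 * k - 1) := by omega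
    have h2 : ¬ (2 ≤ 3 * k ∧ 3 ∣ 3 * k - 2) := by omega
    simp only [← ite_and, h1, h2, if_false]
    simp
  · have h1 : ¬ (0 ≤ 3 * k + 1 ∧ 3 ∣ 3 * k + 1 - 0) := by omega
    have h2 : ¬ (2 ≤ 3 * k + 1 ∧ 3 ∣ 3 * k + 1 - 2) := by omega
    simp only [← ite_and, h1, h2, if_false]
    simp
  · have h1 : ¬ (0 ≤ 3 * k + 2 ∧ 3 ∣ 3 * k + 2 - 0) := by omega
    have h2 : ¬ (1 ≤ 3 * k + 2 ∧ 3 ∣ 3 * k + 2 - 1) := by omega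
    simp only [← ite_and, h1, h2, if_false]
    simp

lemma dis_comb (r : ℕ) (hr : r < 3) (u v w : PS3) :
    dis r (u ^ 3 + X * v ^ 3 + X ^ 2 * w ^ 3) = if r = 0 then u else if r = 1 then v else w := by
  have e : u ^ 3 + X * v ^ 3 + X ^ 2 * w ^ 3 = X ^ 0 * u ^ 3 + X ^ 1 * v ^ 3 + X ^ 2 * w ^ 3 := by
    simp
  rw [e, dis_add, dis_add, dis_X_cube _ _ hr (by norm_num), dis_X_cube _ _ hr (by norm_num),
    dis_X_cube _ _ hr (by norm_num)]
  interval_cases r <;> simp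

lemma dis_cube_mul (r : ℕ) (hr : r < 3) (g f : PS3) : dis r (g ^ 3 * f) = g * dis r f := by
  have e : g ^ 3 * f = (g * dis 0 f) ^ 3 + X * (g * dis 1 f) ^ 3 + X ^ 2 * (g * dis 2 f) ^ 3 := by
    conv_lhs => rw [dis_decomp f]
    ring
  rw [e, dis_comb r hr]
  interval_cases r <;> simp

section alg
variable {A P Q E : PS3}

lemma dis_sq (h2 : dis 2 P = 0) :
    dis 1 (P ^ 2) = 2 * dis 0 P * dis 1 P ∧ dis 2 (P ^ 2) = (dis 1 P) ^ 2 := by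
  have c2 : (2 : PS3) ^ 3 = 2 := by
    have h3 : (3 : PS3) = 0 := by
      have h4 : (3 : ZMod 3) = 0 := rfl
      have h5 : (C (3 : ZMod 3) : PS3) = 3 := map_ofNat _ 3
      rw [← h5, h4, map_zero]
    linear_combination 2 * h3
  have e : P ^ 2 = ((dis 0 P) ^ 2) ^ 3 + X * (2 * dis 0 P * dis 1 P) ^ 3 +
      X ^ 2 * ((dis 1 P) ^ 2) ^ 3 := by
    have h := dis_decomp P
    rw [h2] at h
    conv_lhs => rw [h]
    rw [mul_pow, mul_pow, c2]
    ring
  constructor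
  · rw [e, dis_comb 1 (by norm_num)]; simp
  · rw [e, dis_comb 2 (by norm_num)]; simp

/-- `P` is the series of triangular numbers, `Q` that of `φ(-q)`. -/
lemma dis_main (hP1 : dis 1 P = P ^ 3) (hP2 : dis 2 P = 0) (hQ : dis 0 Q = Q ^ 3)
    (hQ0 : Q ≠ 0) (hP0 : P ≠ 0) (hPQ : Q * P ^ 2 = E ^ 3) (hA : A * Q ^ 8 = P ^ 7) :
    dis 2 (dis 1 A) = 2 * P ^ 7 := by
  obtain ⟨s1, s2⟩ := dis_sq hP2
  -- P * dis 0 Q = E * dis 0 P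
  have k0 : P * dis 0 Q = E * dis 0 P := by
    rw [← dis_cube_mul 0 (by norm_num), ← dis_cube_mul 0 (by norm_num), ← hPQ]
    congr 1; ring
  have k1 : P * dis 1 (P * Q) = P * (2 * Q ^ 3 * P ^ 3) := by
    rw [← dis_cube_mul 1 (by norm_num)]
    have : P ^ 3 * (P * Q) = E ^ 3 * P ^ 2 := by rw [← hPQ]; ring
    rw [this, dis_cube_mul 1 (by norm_num), s1, hP1, ← hQ]
    linear_combination (-2 * P ^ 3) * k0
  have k2 := mul_left_cancel₀ hP0 k1
  have k3 : Q ^ 3 * dis 1 A = Q ^ 3 * (2 * P ^ 5) := by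
    rw [← dis_cube_mul 1 (by norm_num)]
    have : (Q ^ 3) ^ 3 * A = (P ^ 2) ^ 3 * (P * Q) := by linear_combination Q * hA
    rw [this, dis_cube_mul 1 (by norm_num), k2]
    ring
  have k4 := mul_left_cancel₀ (pow_ne_zero 3 hQ0) k3
  have : dis 1 A = P ^ 3 * P ^ 2 + P ^ 3 * P ^ 2 := by rw [k4]; ring
  rw [this, dis_add, dis_cube_mul 2 (by norm_num), s2, hP1]
  ring

lemma dis_P7 (hP1 : dis 1 P = P ^ 3) (hP2 : dis 2 P = 0) :
    dis 2 (P ^ 7) = 0 ∧ dis 2 (dis 1 (P ^ 7)) = P ^ 7 := by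
  obtain ⟨s1, s2⟩ := dis_sq hP2
  have : P ^ 7 = (P ^ 2) ^ 3 * P := by ring
  constructor
  · rw [this, dis_cube_mul 2 (by norm_num), hP2, mul_zero]
  · rw [this, dis_cube_mul 1 (by norm_num), hP1, mul_comm, dis_cube_mul 2 (by norm_num), s2, hP1]
    ring

lemma coeff_final (hP1 : dis 1 P = P ^ 3) (hP2 : dis 2 P = 0) (hA : dis 2 (dis 1 A) = 2 * P ^ 7)
    (α n : ℕ) : coeff (3 ^ (2 * α + 3) * n + (207 * 3 ^ (2 * α) - 7) / 8) A = 0 := by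
  obtain ⟨t1, t2⟩ := dis_P7 hP1 hP2
  have key : ∀ α n : ℕ, ∃ m, 8 * m + 7 = 9 ^ α * (24 * n + 23) ∧ coeff m (P ^ 7) = 0 := by
    intro α n
    induction α with
    | zero =>
      refine ⟨3 * n + 2, by ring, ?_⟩
      rw [← coeff_dis, t1]; simp
    | succ α ih =>
      obtain ⟨m, hm, hc⟩ := ih
      refine ⟨3 * (3 * m + 2) + 1, by rw [pow_succ]; linarith, ?_⟩
      rw [← coeff_dis, ← coeff_dis, t2, hc]
  obtain ⟨m, hm, hc⟩ := key α n
  have e : 3 ^ (2 * α + 3) * n + (207 * 3 ^ (2 * α) - 7) / 8 = 3 * (3 * m + 2) + 1 := by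
    have h1 : 3 ^ (2 * α + 3) = 27 * 9 ^ α := by rw [pow_add, pow_mul]; norm_num; ring
    have h2 : 3 ^ (2 * α) = 9 ^ α := by rw [pow_mul]; norm_num
    rw [h1, h2]
    have : 9 ^ α * (24 * n + 23) = 24 * (9 ^ α * n) + 23 * 9 ^ α := by ring
    rw [this] at hm
    rw [mul_assoc]
    generalize 9 ^ α * n = u at *
    generalize 9 ^ α = v at *
    omega
  rw [e, ← coeff_dis, ← coeff_dis, hA, two_mul, map_add, hc, add_zero]
end alg
section fin
variable {R : Type*} [CommRing R] (x : R)

def cphi (n s : ℕ) : R := (∏ k ∈ Ico s n, (1 - x ^ (k + 1))) * ∏ k ∈ range s, (1 + x ^ (k + 1))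

def Lphi (n : ℕ) : R := ∑ s ∈ range n, (-1) ^ s * x ^ (s * n) * cphi x n s

def Tphi (n : ℕ) : R := ∑ s ∈ range n, ((-1) ^ s * x ^ (s * s) + (-1) ^ (s + 1) * x ^ ((s + 1) * (s + 1)))

lemma cphi_succ {n s : ℕ} (h : s ≤ n) : cphi x (n + 1) s = cphi x n s * (1 - x ^ (n + 1)) := by
  rw [cphi, cphi, Finset.prod_Ico_succ_top h]; ring

lemma cphi_shift {n s : ℕ} (h : s < n) :
    cphi x n s * (1 + x ^ (s + 1)) = cphi x n (s + 1) * (1 - x ^ (s + 1)) := by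
  rw [cphi, cphi, Finset.prod_range_succ, Finset.prod_eq_prod_Ico_succ_bot h]; ring

lemma Lphi_succ (n : ℕ) : Lphi x (n + 1) = (1 + x ^ n) * Lphi x n +
    (∏ k ∈ range n, (1 + x ^ (k + 1))) * (Tphi x (n + 1) - Tphi x n) := by
  have tel : ∀ m ≤ n, ∑ s ∈ range m, ((-1) ^ s * x ^ (s * (n + 1)) * cphi x (n + 1) s
      - (1 + x ^ n) * ((-1) ^ s * x ^ (s * n) * cphi x n s)) =
      (-1) ^ m * x ^ (m * n) * cphi x n m * (1 - x ^ m) := by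
    intro m hm
    induction m with
    | zero => simp
    | succ m ih =>
      rw [Finset.sum_range_succ, ih (by omega), cphi_succ x (by omega)]
      have h := cphi_shift x (n := n) (s := m) (by omega)
      linear_combination (-(-1) ^ m * x ^ (m * n + n)) * h
  have h := tel n le_rfl
  rw [Finset.sum_sub_distrib, ← Finset.mul_sum] at h
  have hc : cphi x n n = ∏ k ∈ range n, (1 + x ^ (k + 1)) := by simp [cphi]
  have hc1 := cphi_succ x (le_refl n)
  rw [Lphi, Finset.sum_range_succ, Lphi, Tphi, Finset.sum_range_succ, ← Tphi, hc1, ← hc]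
  linear_combination h

lemma Lphi_eq (n : ℕ) :
    Lphi x (n + 1) = Tphi x (n + 1) * ∏ k ∈ range n, (1 + x ^ (k + 1)) := by
  induction n with
  | zero => rw [Lphi_succ]; simp [Lphi, Tphi]
  | succ n ih => rw [Lphi_succ, ih, Finset.prod_range_succ]; ring

lemma Lphi_dvd (n : ℕ) :
    x ^ n ∣ Lphi x n - ∏ k ∈ range n, (1 - x ^ (k + 1)) := by
  cases n with
  | zero => simp
  | succ n =>
    rw [Lphi, Finset.sum_range_succ']
    have : (-1) ^ 0 * x ^ (0 * (n + 1)) * cphi x (n + 1) 0 = ∏ k ∈ range (n + 1), (1 - x ^ (k + 1)) := by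
      simp [cphi]
    rw [this, add_sub_cancel_right]
    refine Finset.dvd_sum fun s _ => ?_
    refine Dvd.dvd.mul_right (Dvd.dvd.mul_left (pow_dvd_pow _ ?_) _) _
    nlinarith

def cpsi (n s : ℕ) : R :=
  (∏ k ∈ Ico s n, (1 - x ^ (2 * k + 2))) * ∏ k ∈ range s, (1 - x ^ (2 * k + 1))

def Lpsi (n : ℕ) : R := ∑ s ∈ range (n + 1), x ^ (s * (2 * n + 1)) * cpsi x n s

def tri (s : ℕ) : ℕ := s * (s + 1) / 2

lemma two_tri (s : ℕ) : 2 * tri s = s * (s + 1) :=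
  Nat.mul_div_cancel' (Nat.even_mul_succ_self s).two_dvd

def Tpsi (n : ℕ) : R := ∑ s ∈ range (2 * n + 1), x ^ tri s

lemma cpsi_succ {n s : ℕ} (h : s ≤ n) : cpsi x (n + 1) s = cpsi x n s * (1 - x ^ (2 * n + 2)) := by
  rw [cpsi, cpsi, Finset.prod_Ico_succ_top h]; ring

lemma cpsi_shift {n s : ℕ} (h : s < n) :
    cpsi x n s * (1 - x ^ (2 * s + 1)) = cpsi x n (s + 1) * (1 - x ^ (2 * s + 2)) := by
  rw [cpsi, cpsi, Finset.prod_range_succ, Finset.prod_eq_prod_Ico_succ_bot h]; ring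

lemma Lpsi_succ (n : ℕ) : Lpsi x (n + 1) = (1 - x ^ (2 * n + 1)) * Lpsi x n +
    (∏ k ∈ range (n + 1), (1 - x ^ (2 * k + 1))) * (Tpsi x (n + 1) - Tpsi x n) := by
  have tel : ∀ m ≤ n, ∑ s ∈ range m, (x ^ (s * (2 * (n + 1) + 1)) * cpsi x (n + 1) s
      - (1 - x ^ (2 * n + 1)) * (x ^ (s * (2 * n + 1)) * cpsi x n s)) =
      x ^ (m * (2 * n + 1)) * cpsi x n m * (1 - x ^ (2 * m)) := by
    intro m hm
    induction m with
    | zero => simp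
    | succ m ih =>
      rw [Finset.sum_range_succ, ih (by omega), cpsi_succ x (by omega)]
      have h := cpsi_shift x (n := n) (s := m) (by omega)
      linear_combination (x ^ ((m + 1) * (2 * n + 1))) * h
  have h := tel n le_rfl
  rw [Finset.sum_sub_distrib, ← Finset.mul_sum] at h
  have hc : cpsi x n n = ∏ k ∈ range n, (1 - x ^ (2 * k + 1)) := by simp [cpsi]
  have hc2 : cpsi x (n + 1) (n + 1) = ∏ k ∈ range (n + 1), (1 - x ^ (2 * k + 1)) := by simp [cpsi]
  have hc1 := cpsi_succ x (le_refl n)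
  have t1 : tri (2 * n + 1) = (n + 1) * (2 * n + 1) := by
    have := two_tri (2 * n + 1)
    nlinarith
  have t2 : tri (2 * n + 1 + 1) = (n + 1) * (2 * n + 3) := by
    have := two_tri (2 * n + 1 + 1)
    nlinarith
  have hT : Tpsi x (n + 1) = Tpsi x n + x ^ ((n + 1) * (2 * n + 1)) + x ^ ((n + 1) * (2 * n + 3)) := by
    rw [Tpsi, show 2 * (n + 1) + 1 = 2 * n + 1 + 1 + 1 by ring, Finset.sum_range_succ,
      Finset.sum_range_succ, t1, t2, ← Tpsi]
  rw [Lpsi, Finset.sum_range_succ, Finset.sum_range_succ, Lpsi, Finset.sum_range_succ, hT, hc1, hc2,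
    Finset.prod_range_succ, ← hc]
  linear_combination h

lemma Lpsi_eq (n : ℕ) :
    Lpsi x n = Tpsi x n * ∏ k ∈ range n, (1 - x ^ (2 * k + 1)) := by
  induction n with
  | zero => simp [Lpsi, Tpsi, cpsi, tri]
  | succ n ih => rw [Lpsi_succ, ih, Finset.prod_range_succ]; ring

lemma Lpsi_dvd (n : ℕ) :
    x ^ n ∣ Lpsi x n - ∏ k ∈ range n, (1 - x ^ (2 * k + 2)) := by
  rw [Lpsi, Finset.sum_range_succ']
  have : x ^ (0 * (2 * n + 1)) * cpsi x n 0 = ∏ k ∈ range n, (1 - x ^ (2 * k + 2)) := by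
    simp [cpsi]
  rw [this, add_sub_cancel_right]
  refine Finset.dvd_sum fun s _ => ?_
  refine Dvd.dvd.mul_right (pow_dvd_pow _ ?_) _
  nlinarith

lemma prod_MN (n : ℕ) : (∏ k ∈ range n, (1 - x ^ (k + 1))) * (∏ k ∈ range n, (1 + x ^ (k + 1))) =
    ∏ k ∈ range n, (1 - x ^ (2 * k + 2)) := by
  rw [← Finset.prod_mul_distrib]
  exact Finset.prod_congr rfl fun k _ => by ring

lemma prod_OE (n : ℕ) : ∏ k ∈ range (2 * n), (1 - x ^ (k + 1)) =
    (∏ k ∈ range n, (1 - x ^ (2 * k + 1))) * ∏ k ∈ range n, (1 - x ^ (2 * k + 2)) := by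
  induction n with
  | zero => simp
  | succ n ih =>
    rw [show 2 * (n + 1) = 2 * n + 1 + 1 by ring, Finset.prod_range_succ, Finset.prod_range_succ, ih,
      Finset.prod_range_succ, Finset.prod_range_succ]
    ring
end fin

section lim
open Filter Topology PowerSeries.WithPiTopology

lemma tendsto_of_coeff {u : ℕ → PS3} {l : PS3}
    (h : ∀ d, ∀ᶠ n in atTop, coeff d (u n) = coeff d l) : Tendsto u atTop (𝓝 l) := by
  rw [tendsto_iff_coeff_tendsto]
  intro d
  exact tendsto_nhds_of_eventually_eq (h d)

lemma coeff_of_tendsto {u : ℕ → PS3} {l : PS3} (h : Tendsto u atTop (𝓝 l)) (d : ℕ) :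
    ∀ᶠ n in atTop, coeff d (u n) = coeff d l := by
  rw [tendsto_iff_coeff_tendsto] at h
  have := h d
  rwa [nhds_discrete, tendsto_pure] at this

lemma tendsto_of_dvd {u v : ℕ → PS3} {l : PS3} (h : ∀ n, X ^ n ∣ u n - v n)
    (hv : Tendsto v atTop (𝓝 l)) : Tendsto u atTop (𝓝 l) := by
  apply tendsto_of_coeff
  intro d
  filter_upwards [coeff_of_tendsto hv d, eventually_gt_atTop d] with n h1 h2
  rw [← h1, ← sub_eq_zero, ← map_sub]
  exact (PowerSeries.X_pow_dvd_iff.mp (h n)) d h2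

lemma exists_prod (f : ℕ → PS3) (h : ∀ n, X ^ n ∣ f n) :
    ∃ l, Tendsto (fun n => ∏ k ∈ range n, (1 + f k)) atTop (𝓝 l) := by
  have := multipliable_one_add_of_tendsto_order_atTop_nhds_top (ZMod 3) (f := f) (by
    refine ENat.tendsto_nhds_top_iff_natCast_lt.mpr fun n => eventually_atTop.mpr ⟨n + 1, ?_⟩
    intro m hm
    have : (m : ℕ∞) ≤ (f m).order := by
      apply PowerSeries.le_order
      intro i hi
      exact (PowerSeries.X_pow_dvd_iff.mp (h m)) i (by exact_mod_cast hi)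
    refine lt_of_lt_of_le ?_ this
    exact_mod_cast hm)
  exact ⟨_, this.hasProd.tendsto_prod_nat⟩

lemma tendsto_series (c : ℕ → ZMod 3) (e : ℕ → ℕ) (he : ∀ k, k ≤ e k) (hinj : Function.Injective e)
    (F : PS3) (h1 : ∀ k, coeff (e k) F = c k) (h2 : ∀ d, (∀ k, e k ≠ d) → coeff d F = 0) :
    Tendsto (fun n => ∑ s ∈ range n, C (c s) * X ^ e s) atTop (𝓝 F) := by
  apply tendsto_of_coeff
  intro d
  filter_upwards [eventually_gt_atTop d] with n hn
  simp only [map_sum, PowerSeries.coeff_C_mul, PowerSeries.coeff_X_pow]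
  by_cases hd : ∃ k, e k = d
  · obtain ⟨k, rfl⟩ := hd
    rw [Finset.sum_eq_single k, h1]
    · simp
    · intro b _ hb
      have : e k ≠ e b := fun h => hb (hinj h).symm
      simp [this]
    · intro hk
      exact absurd (Finset.mem_range.mpr (lt_of_le_of_lt (he k) hn)) hk
  · push Not at hd
    rw [h2 d hd]
    exact Finset.sum_eq_zero fun k _ => by simp [(hd k).symm]

open Classical in
noncomputable def serP : PS3 := PowerSeries.mk fun n => if ∃ k, tri k = n then 1 else 0

open Classical in
noncomputable def serQ0 : PS3 := PowerSeries.mk fun n => if ∃ k, k * k = n then (-1) ^ n else 0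

noncomputable def serQ : PS3 := serQ0 + serQ0 - 1

lemma le_tri (k : ℕ) : k ≤ tri k := by
  have := two_tri k
  nlinarith [Nat.zero_le k, Nat.le_mul_self k]

lemma tri_inj : Function.Injective tri := by
  intro i j h
  have h1 := two_tri i
  have h2 := two_tri j
  rw [h] at h1
  rcases lt_trichotomy i j with h | h | h
  · nlinarith
  · exact h
  · nlinarith

lemma tendsto_P : Tendsto (fun n => Tpsi (X : PS3) n) atTop (𝓝 serP) := by
  have := tendsto_series (fun _ => 1) tri le_tri tri_inj serP (fun k => by simp [serP])
    (fun d hd => by simp [serP, hd])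
  have h2 : Tendsto (fun n : ℕ => 2 * n + 1) atTop atTop :=
    tendsto_atTop_mono (fun n => by simp only [id]; omega) tendsto_id
  have h3 := this.comp h2
  simpa [Function.comp_def, Tpsi] using h3

lemma tendsto_Q0 : Tendsto (fun n => ∑ s ∈ range n, (-1) ^ s * (X : PS3) ^ (s * s)) atTop (𝓝 serQ0) := by
  have := tendsto_series (fun s => (-1) ^ s) (fun s => s * s) Nat.le_mul_self
    (fun i j h => Nat.mul_self_inj.mp h) serQ0
    (fun k => by
      have : ∃ j, j * j = k * k := ⟨k, rfl⟩
      simp only [serQ0, PowerSeries.coeff_mk, this, if_true]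
      rcases Nat.even_or_odd k with h | h
      · rw [h.neg_one_pow, (h.mul_right k).neg_one_pow]
      · rw [h.neg_one_pow, (h.mul h).neg_one_pow])
    (fun d hd => by simp [serQ0, hd])
  simpa using this

lemma tendsto_Q : Tendsto (fun n => Tphi (X : PS3) n) atTop (𝓝 serQ) := by
  have h2 := (tendsto_Q0.add (tendsto_Q0.comp (tendsto_add_atTop_nat 1))).sub_const (1 : PS3)
  refine h2.congr fun n => ?_
  simp only [Function.comp, Tphi, Finset.sum_add_distrib]
  rw [Finset.sum_range_succ' (fun s => (-1) ^ s * (X : PS3) ^ (s * s))]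
  simp only [pow_zero, mul_zero, mul_one]
  ring

lemma exists_OE : ∃ O E : PS3,
    Tendsto (fun n => ∏ k ∈ range n, (1 - (X : PS3) ^ (2 * k + 1))) atTop (𝓝 O) ∧
    Tendsto (fun n => ∏ k ∈ range n, (1 - (X : PS3) ^ (2 * k + 2))) atTop (𝓝 E) ∧
    serP * O = E ∧ (E ≠ 0 → serQ = O ^ 2 * E) := by
  obtain ⟨O, hO⟩ := exists_prod (fun k => - X ^ (2 * k + 1))
    (fun n => (dvd_neg.mpr (pow_dvd_pow _ (by omega))))
  obtain ⟨E, hE⟩ := exists_prod (fun k => - X ^ (2 * k + 2))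
    (fun n => (dvd_neg.mpr (pow_dvd_pow _ (by omega))))
  obtain ⟨M, hM⟩ := exists_prod (fun k => - X ^ (k + 1))
    (fun n => (dvd_neg.mpr (pow_dvd_pow _ (by omega))))
  obtain ⟨N, hN⟩ := exists_prod (fun k => X ^ (k + 1))
    (fun n => (pow_dvd_pow _ (by omega)))
  simp only [← sub_eq_add_neg] at hO hE hM
  have hMN : M * N = E := by
    refine tendsto_nhds_unique (hM.mul hN) ?_
    simpa only [prod_MN] using hE
  have hOE : O * E = M := by
    refine tendsto_nhds_unique (hO.mul hE) ?_
    have h2 : Tendsto (fun n : ℕ => 2 * n) atTop atTop :=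
      tendsto_atTop_mono (fun n => by simp only [id]; omega) tendsto_id
    have := hM.comp h2
    simpa only [Function.comp_def, prod_OE] using this
  have hP : serP * O = E := by
    refine tendsto_nhds_unique (tendsto_P.mul hO) ?_
    have := tendsto_of_dvd (fun n => Lpsi_dvd (X : PS3) n) hE
    exact this.congr fun n => Lpsi_eq _ n
  have hQ : serQ * N = M := by
    have h1 := tendsto_of_dvd (fun n => Lphi_dvd (X : PS3) n) hM
    have h2 := h1.comp (tendsto_add_atTop_nat 1)
    refine tendsto_nhds_unique ((tendsto_Q.comp (tendsto_add_atTop_nat 1)).mul hN) ?_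
    simpa only [Function.comp_def, Lphi_eq] using h2
  refine ⟨O, E, hO, hE, hP, fun hE0 => ?_⟩
  apply mul_right_cancel₀ hE0
  calc serQ * E = (serQ * N) * M := by rw [← hMN]; ring
    _ = O ^ 2 * E * E := by rw [hQ, ← hOE]; ring

open Classical in
lemma disP1 : dis 1 serP = serP ^ 3 := by
  ext n
  rw [coeff_dis, coeff_cube, serP, PowerSeries.coeff_mk, PowerSeries.coeff_mk, ← ite_and]
  refine if_congr ?_ rfl rfl
  constructor
  · rintro ⟨k, hk⟩
    have h := two_tri k
    rw [hk] at h
    obtain ⟨j, rfl | rfl | rfl⟩ : ∃ j, k = 3 * j ∨ k = 3 * j + 1 ∨ k = 3 * j + 2 := ⟨k / 3, by omega⟩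
    · ring_nf at h; omega
    · have h2 := two_tri j
      have : n = 3 * tri j := by nlinarith
      exact ⟨⟨_, this⟩, j, by omega⟩
    · ring_nf at h; omega
  · rintro ⟨⟨m, rfl⟩, j, hj⟩
    refine ⟨3 * j + 1, ?_⟩
    have h := two_tri (3 * j + 1)
    have h2 := two_tri j
    have h3 : tri j = m := by omega
    rw [← h3]; nlinarith

lemma disP2 : dis 2 serP = 0 := by
  ext n
  rw [coeff_dis, serP, PowerSeries.coeff_mk, if_neg, map_zero]
  rintro ⟨k, hk⟩
  have h := two_tri k
  rw [hk] at h
  obtain ⟨j, rfl | rfl | rfl⟩ : ∃ j, k = 3 * j ∨ k = 3 * j + 1 ∨ k = 3 * j + 2 := ⟨k / 3, by omega⟩ <;>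
  · ring_nf at h; omega

lemma disQ0 : dis 0 serQ0 = serQ0 ^ 3 := by
  ext n
  rw [coeff_dis, coeff_cube, serQ0, PowerSeries.coeff_mk, PowerSeries.coeff_mk, ← ite_and]
  by_cases h : 3 ∣ n ∧ ∃ k, k * k = n / 3
  · rw [if_pos h]
    obtain ⟨⟨m, rfl⟩, j, hj⟩ := h
    have hm : m = j * j := by omega
    rw [if_pos ⟨3 * j, by rw [hm]; ring⟩]
    rw [show 3 * (3 * m) + 0 = m + 2 * (4 * m) by ring, pow_add, pow_mul]
    simp
  · rw [if_neg h, if_neg]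
    rintro ⟨k, hk⟩
    apply h
    have h3 : 3 ∣ k := by
      have : 3 ∣ k * k := ⟨n, by omega⟩
      exact (Nat.prime_three.dvd_mul.mp this).elim id id
    obtain ⟨j, rfl⟩ := h3
    have : n = 3 * (j * j) := by nlinarith
    exact ⟨⟨_, this⟩, j, by omega⟩

lemma disQ : dis 0 serQ = serQ ^ 3 := by
  have h1 : dis 0 (1 : PS3) = 1 := by
    have := dis_X_cube 0 0 (by norm_num) (by norm_num) 1
    simpa using this
  have hs : dis 0 serQ + dis 0 1 = dis 0 serQ0 + dis 0 serQ0 := by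
    rw [← dis_add, ← dis_add]; congr 1; simp [serQ]
  have h3 : (3 : PS3) = 0 := by
    have h4 : (3 : ZMod 3) = 0 := rfl
    have h5 : (C (3 : ZMod 3) : PS3) = 3 := map_ofNat _ 3
    rw [← h5, h4, map_zero]
  rw [h1, disQ0] at hs
  rw [eq_sub_of_add_eq hs, serQ]
  linear_combination (-2 * serQ0 ^ 3 + 4 * serQ0 ^ 2 - 2 * serQ0) * h3
end lim

section gf
open Filter Topology PowerSeries.WithPiTopology

def MS (S : Finset (ℕ × ℕ)) (n : ℕ) : Set (Multiset (ℕ × ℕ)) :=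
  {s | (∀ p ∈ s, p ∈ S) ∧ (s.map Prod.fst).sum = n}

lemma MS_insert_lt {S : Finset (ℕ × ℕ)} {p : ℕ × ℕ} {n : ℕ} (hn : n < p.1) :
    MS (insert p S) n = MS S n := by
  ext s
  simp only [MS, Set.mem_ofPred_eq]
  constructor
  · rintro ⟨h1, h2⟩
    refine ⟨fun q hq => ?_, h2⟩
    rcases Finset.mem_insert.mp (h1 q hq) with rfl | h
    · have := Multiset.le_sum_of_mem (Multiset.mem_map_of_mem Prod.fst hq)
      omega
    · exact h
  · rintro ⟨h1, h2⟩
    exact ⟨fun q hq => Finset.mem_insert_of_mem (h1 q hq), h2⟩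

lemma MS_insert_add {S : Finset (ℕ × ℕ)} {p : ℕ × ℕ} {n : ℕ} :
    MS (insert p S) (n + p.1) = MS S (n + p.1) ∪ (fun s => p ::ₘ s) '' MS (insert p S) n := by
  ext s
  simp only [MS, Set.mem_ofPred_eq, Set.mem_union, Set.mem_image]
  constructor
  · rintro ⟨h1, h2⟩
    by_cases hp : p ∈ s
    · right
      obtain ⟨t, rfl⟩ := Multiset.exists_cons_of_mem hp
      refine ⟨t, ⟨fun q hq => h1 q (Multiset.mem_cons_of_mem hq), ?_⟩, rfl⟩
      simp at h2; omega
    · left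
      refine ⟨fun q hq => ?_, h2⟩
      rcases Finset.mem_insert.mp (h1 q hq) with rfl | h
      · exact absurd hq hp
      · exact h
  · rintro (⟨h1, h2⟩ | ⟨t, ⟨h1, h2⟩, rfl⟩)
    · exact ⟨fun q hq => Finset.mem_insert_of_mem (h1 q hq), h2⟩
    · refine ⟨fun q hq => ?_, by simp [h2, add_comm]⟩
      rcases Multiset.mem_cons.mp hq with rfl | h
      · exact Finset.mem_insert_self _ _
      · exact h1 q h

lemma MS_empty_zero : MS ∅ 0 = {0} := by
  ext s
  simp only [MS, Set.mem_ofPred_eq, Set.mem_singleton_iff]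
  constructor
  · rintro ⟨h1, _⟩
    exact Multiset.eq_zero_of_forall_notMem fun q hq => by simpa using h1 q hq
  · rintro rfl; simp

lemma MS_empty_pos {n : ℕ} (hn : n ≠ 0) : MS ∅ n = ∅ := by
  ext s
  simp only [MS, Set.mem_ofPred_eq, Set.mem_empty_iff_false, iff_false]
  rintro ⟨h1, h2⟩
  have : s = 0 := Multiset.eq_zero_of_forall_notMem fun q hq => by simpa using h1 q hq
  subst this
  simp at h2; omega

lemma MS_finite (S : Finset (ℕ × ℕ)) (hS : ∀ p ∈ S, 0 < p.1) (n : ℕ) : (MS S n).Finite := by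
  induction S using Finset.induction_on generalizing n with
  | empty =>
    rcases eq_or_ne n 0 with rfl | h
    · rw [MS_empty_zero]; exact Set.finite_singleton _
    · rw [MS_empty_pos h]; exact Set.finite_empty
  | insert p S hp ih =>
    have ih' := ih fun q hq => hS q (Finset.mem_insert_of_mem hq)
    have hpos := hS p (Finset.mem_insert_self _ _)
    induction n using Nat.strong_induction_on with
    | _ n ihn =>
      rcases lt_or_ge n p.1 with h | h
      · rw [MS_insert_lt h]; exact ih' n
      · obtain ⟨m, rfl⟩ := Nat.exists_eq_add_of_le' h
        rw [MS_insert_add]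
        exact (ih' _).union ((ihn m (by omega)).image _)

noncomputable def gfS (S : Finset (ℕ × ℕ)) : PS3 := PowerSeries.mk fun n => ((MS S n).ncard : ZMod 3)

lemma gfS_insert (S : Finset (ℕ × ℕ)) (p : ℕ × ℕ) (hp : p ∉ S) (hS : ∀ q ∈ insert p S, 0 < q.1) :
    gfS (insert p S) * (1 - X ^ p.1) = gfS S := by
  ext n
  rw [mul_sub, mul_one, map_sub, PowerSeries.coeff_mul_X_pow', sub_eq_iff_eq_add]
  simp only [gfS, PowerSeries.coeff_mk]
  rcases lt_or_ge n p.1 with h | h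
  · rw [MS_insert_lt h, if_neg (by omega), add_zero]
  · obtain ⟨m, rfl⟩ := Nat.exists_eq_add_of_le' h
    rw [if_pos h, MS_insert_add, Nat.add_sub_cancel, Set.ncard_union_eq ?_
      (MS_finite S (fun q hq => hS q (Finset.mem_insert_of_mem hq)) _)
      ((MS_finite _ hS _).image _), Set.ncard_image_of_injective]
    · push_cast; rfl
    · intro s t hst
      exact (Multiset.cons_inj_right p).mp hst
    · rw [Set.disjoint_left]
      rintro s ⟨h1, _⟩ ⟨t, _, rfl⟩
      exact hp (h1 p (Multiset.mem_cons_self p t))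

lemma gfS_mul (S : Finset (ℕ × ℕ)) (hS : ∀ p ∈ S, 0 < p.1) :
    gfS S * ∏ p ∈ S, (1 - X ^ p.1) = 1 := by
  induction S using Finset.induction_on with
  | empty =>
    ext n
    rw [Finset.prod_empty, mul_one, gfS, PowerSeries.coeff_mk, PowerSeries.coeff_one]
    rcases eq_or_ne n 0 with rfl | h
    · simp [MS_empty_zero]
    · simp [MS_empty_pos h, h]
  | insert p S hp ih =>
    rw [Finset.prod_insert hp, ← mul_assoc, gfS_insert S p hp hS]
    exact ih fun q hq => hS q (Finset.mem_insert_of_mem hq)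

def SN (n : ℕ) : Finset (ℕ × ℕ) :=
  ((range n).image fun k => 2 * k + 1) ×ˢ Icc 1 23 ∪ ((range n).image fun k => 2 * k + 2) ×ˢ {1}

lemma mem_SN (n : ℕ) (p : ℕ × ℕ) :
    p ∈ SN n ↔ p.1 ≤ 2 * n ∧ 0 < p.1 ∧ 1 ≤ p.2 ∧ p.2 ≤ 23 ∧ (Even p.1 → p.2 = 1) := by
  simp only [SN, Finset.mem_union, Finset.mem_product, Finset.mem_image, Finset.mem_range,
    Finset.mem_Icc, Finset.mem_singleton]
  constructor
  · rintro (⟨⟨k, hk, h⟩, h1, h2⟩ | ⟨⟨k, hk, h⟩, h1⟩)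
    · refine ⟨by omega, by omega, h1, h2, fun he => ?_⟩
      obtain ⟨r, hr⟩ := he
      omega
    · exact ⟨by omega, by omega, by omega, by omega, fun _ => h1⟩
  · rintro ⟨h1, h2, h3, h4, h5⟩
    rcases Nat.even_or_odd' p.1 with ⟨k, hk | hk⟩
    · right
      exact ⟨⟨k - 1, by omega, by omega⟩, h5 ⟨k, by omega⟩⟩
    · left
      exact ⟨⟨k, by omega, by omega⟩, h3, h4⟩

lemma prod_SN (n : ℕ) : ∏ p ∈ SN n, (1 - (X : PS3) ^ p.1) =
    (∏ k ∈ range n, (1 - (X : PS3) ^ (2 * k + 1))) ^ 23 * ∏ k ∈ range n, (1 - (X : PS3) ^ (2 * k + 2)) := by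
  rw [SN, Finset.prod_union, Finset.prod_product, Finset.prod_product, Finset.prod_image,
    Finset.prod_image]
  · simp [Finset.prod_pow]
  · intro i _ j _ h
    simp only at h; omega
  · intro i _ j _ h
    simp only at h; omega
  · rw [Finset.disjoint_left]
    intro p hp hq
    simp only [Finset.mem_product, Finset.mem_image] at hp hq
    obtain ⟨⟨i, _, hi⟩, _⟩ := hp
    obtain ⟨⟨j, _, hj⟩, _⟩ := hq
    omega

noncomputable def serA : PS3 := PowerSeries.mk fun n => (a 23 n : ZMod 3)

lemma MS_SN {n d : ℕ} (h : d ≤ 2 * n) : MS (SN n) d = coloredOddPartitions 23 d := by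
  ext s
  simp only [MS, coloredOddPartitions, Set.mem_ofPred_eq, mem_SN]
  constructor
  · rintro ⟨h1, h2⟩
    exact ⟨fun p hp => (h1 p hp).2, h2⟩
  · rintro ⟨h1, h2⟩
    refine ⟨fun p hp => ⟨?_, h1 p hp⟩, h2⟩
    have := Multiset.le_sum_of_mem (Multiset.mem_map_of_mem Prod.fst hp)
    omega

lemma tendsto_A : Tendsto (fun n => gfS (SN n)) atTop (𝓝 serA) := by
  apply tendsto_of_coeff
  intro d
  filter_upwards [eventually_ge_atTop d] with n hn
  rw [gfS, serA, PowerSeries.coeff_mk, PowerSeries.coeff_mk, MS_SN (by omega), a,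
    Nat.card_coe_set_eq]

lemma serA_main : dis 2 (dis 1 serA) = 2 * serP ^ 7 := by
  obtain ⟨O, E, hO, hE, hP, hQ⟩ := exists_OE
  have hA : serA * (O ^ 23 * E) = 1 := by
    refine tendsto_nhds_unique (tendsto_A.mul ((hO.pow 23).mul hE)) ?_
    refine tendsto_const_nhds.congr fun n => ?_
    rw [← prod_SN, gfS_mul]
    intro p hp
    exact ((mem_SN n p).mp hp).2.1
  have hE0 : E ≠ 0 := by rintro rfl; simp at hA
  have hO0 : O ≠ 0 := by rintro rfl; simp at hA
  have hQ' := hQ hE0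
  refine dis_main (E := E) disP1 disP2 disQ ?_ ?_ ?_ ?_
  · rw [hQ']; exact mul_ne_zero (pow_ne_zero _ hO0) hE0
  · intro h; rw [h, zero_mul] at hP; exact hE0 hP.symm
  · rw [hQ']; linear_combination (E * (serP * O + E)) * hP
  · apply mul_right_cancel₀ (pow_ne_zero 7 hO0)
    rw [← mul_pow, hP, hQ']
    linear_combination E ^ 7 * hA
end gf

theorem stmt6 (α n : ℕ) :
    a 23 (3 ^ (2 * α + 3) * n + (207 * 3 ^ (2 * α) - 7) / 8) ≡ 0 [MOD 3] := by
  have h := coeff_final disP1 disP2 serA_main α n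
  rw [serA, PowerSeries.coeff_mk] at h
  exact (Nat.modEq_zero_iff_dvd).mpr ((ZMod.natCast_eq_zero_iff _ _).mp h)
end

section
/- For all integers j ≥ 0, every integer t with 0 ≤ t ≤ 8, and all integers n ≥ 0, a_{27j+3t+2}(27n + 18 + t) ≡ 0 (mod 3). -/
namespace OddCol
open PowerSeries Finset

abbrev PS := PowerSeries (ZMod 3)

theorem ps_eq {P Q : PS} (h : ∀ N, (X : PS) ^ N ∣ P - Q) : P = Q := by
  ext n
  have := (X_pow_dvd_iff.mp (h (n+1))) n (by omega)
  rw [map_sub, sub_eq_zero] at this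
  exact this

noncomputable def iprod (g : ℕ → PS) : PS :=
  mk fun n => coeff n (∏ i ∈ range (n+1), g i)

theorem iprod_step (g : ℕ → PS) (hg : ∀ i, (X : PS) ^ (i+1) ∣ g i - 1) (N d : ℕ) :
    (X : PS) ^ N ∣ (∏ i ∈ range (N+d), g i) - ∏ i ∈ range N, g i := by
  induction d with
  | zero => simp
  | succ d ih =>
    rw [← add_assoc, prod_range_succ]
    have h1 : (X : PS) ^ N ∣ g (N+d) - 1 := (pow_dvd_pow _ (by omega)).trans (hg (N+d))
    have := dvd_add ih (h1.mul_left (∏ i ∈ range (N+d), g i))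
    convert this using 1
    ring

theorem iprod_spec (g : ℕ → PS) (hg : ∀ i, (X : PS) ^ (i+1) ∣ g i - 1) (N : ℕ) :
    (X : PS) ^ N ∣ iprod g - ∏ i ∈ range N, g i := by
  rw [X_pow_dvd_iff]
  intro m hm
  have h := iprod_step g hg (m+1) (N-(m+1))
  rw [show m+1+(N-(m+1)) = N by omega] at h
  have := (X_pow_dvd_iff.mp h) m (by omega)
  rw [map_sub, sub_eq_zero] at this
  rw [map_sub, iprod, coeff_mk, this, sub_self]

/-- Gaussian binomials -/
noncomputable def gb (q : PS) : ℕ → ℕ → PS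
  | _, 0 => 1
  | 0, _+1 => 0
  | M+1, k+1 => gb q M k + q^(k+1) * gb q M (k+1)

theorem gb_zero (q : PS) (M) : gb q M 0 = 1 := by cases M <;> rfl

theorem gb_succ (q : PS) (M k) :
    gb q (M+1) (k+1) = gb q M k + q^(k+1) * gb q M (k+1) := rfl

theorem gb_gt (q : PS) (M k : ℕ) (h : M < k) : gb q M k = 0 := by
  induction M generalizing k with
  | zero => obtain ⟨k, rfl⟩ : ∃ m, k = m+1 := ⟨k-1, by omega⟩; rfl
  | succ M ih =>
    obtain ⟨k, rfl⟩ : ∃ m, k = m+1 := ⟨k-1, by omega⟩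
    rw [gb_succ, ih k (by omega), ih (k+1) (by omega)]; simp

theorem gb_self (q : PS) (M : ℕ) : gb q M M = 1 := by
  induction M with
  | zero => rfl
  | succ M ih => rw [gb_succ, ih, gb_gt q M (M+1) (by omega)]; simp

theorem gb_formula (q : PS) (M k l : ℕ) (h : k + l = M) :
    gb q M k * (∏ i ∈ range k, (1 - q^(i+1))) * (∏ i ∈ range l, (1 - q^(i+1)))
      = ∏ i ∈ range M, (1 - q^(i+1)) := by
  induction M generalizing k l with
  | zero =>
    obtain ⟨rfl, rfl⟩ : k = 0 ∧ l = 0 := by omega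
    simp [gb_zero]
  | succ M ih =>
    rcases k with _ | k
    · obtain rfl : l = M+1 := by omega
      simp [gb_zero]
    rcases l with _ | l
    · obtain rfl : k = M := by omega
      simp [gb_self]
    have h1 := ih k (l+1) (by omega)
    have h2 := ih (k+1) l (by omega)
    obtain rfl : M = k + l + 1 := by omega
    rw [prod_range_succ _ (k+l+1), gb_succ]
    have e : q^(k+l+1+1) = q^(k+1) * q^(l+1) := by ring
    rw [e]
    rw [prod_range_succ _ l] at h1 ⊢
    rw [prod_range_succ _ k] at h2 ⊢
    linear_combination (1 - q^(k+1)) * h1 + q^(k+1) * (1 - q^(l+1)) * h2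

theorem qbinom (q x y : PS) (M : ℕ) :
    ∏ i ∈ range M, (x + y * q^i) =
      ∑ p ∈ antidiagonal M, q^(p.1.choose 2) * gb q M p.1 * y^p.1 * x^p.2 := by
  induction M generalizing y with
  | zero => simp [gb_zero]
  | succ M ih =>
    rw [prod_range_succ']
    have : ∀ i, x + y * q^(i+1) = x + (y*q) * q^i := fun i => by ring
    simp_rw [this]
    rw [ih, Finset.Nat.sum_antidiagonal_succ]
    have key : ∀ p : ℕ × ℕ, q ^ (p.1+1).choose 2 * gb q (M+1) (p.1+1) * y^(p.1+1) * x^p.2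
        = (q^(p.1.choose 2) * gb q M p.1 * (y*q)^p.1 * x^p.2) * y
          + q^((p.1+1).choose 2) * gb q M (p.1+1) * (y*q)^(p.1+1) * x^p.2 := by
      intro p
      rw [gb_succ, Nat.choose_succ_succ' p.1 1, Nat.choose_one_right]
      ring
    simp_rw [key]
    rw [sum_add_distrib, ← Finset.sum_mul]
    have h3 := Finset.Nat.sum_antidiagonal_succ (n := M)
      (f := fun p => q^(p.1.choose 2) * gb q M p.1 * (y*q)^p.1 * x^p.2)
    have h4 := Finset.Nat.sum_antidiagonal_succ' (n := M)
      (f := fun p => q^(p.1.choose 2) * gb q M p.1 * (y*q)^p.1 * x^p.2)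
    simp only [gb_gt q M (M+1) (by omega)] at h4
    simp only [pow_succ x, ← mul_assoc, ← Finset.sum_mul] at h4
    simp only [gb_zero] at h3 ⊢
    simp at h3 h4 ⊢
    linear_combination h3 - h4

end OddCol
namespace OddCol
open PowerSeries Finset

def sg (j : ℤ) : ZMod 3 := if Even j then 1 else -1

def ex (a b : ℕ) (j : ℤ) : ℕ := ((a:ℤ) * j^2 + b * j).toNat

theorem ex_ge' (a b : ℕ) (h : b < a) (j : ℤ) : |j| ≤ (a:ℤ) * j^2 + b * j := by
  have h' : (b:ℤ) + 1 ≤ a := by exact_mod_cast h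
  have hb : (0:ℤ) ≤ b := by positivity
  rcases abs_cases j with ⟨h1, h2⟩ | ⟨h1, h2⟩ <;> rw [h1]
  · have : j ≤ j^2 := by nlinarith [Int.le_self_sq j]
    nlinarith [mul_nonneg hb h2]
  · have h3 : -j ≤ j^2 := by nlinarith [Int.le_self_sq (-j)]
    nlinarith [mul_le_mul_of_nonneg_left h3 hb]

theorem ex_cast (a b : ℕ) (h : b < a) (j : ℤ) : (ex a b j : ℤ) = (a:ℤ) * j^2 + b * j :=
  Int.toNat_of_nonneg ((abs_nonneg j).trans (ex_ge' a b h j))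

theorem ex_ge (a b : ℕ) (h : b < a) (j : ℤ) : |j| ≤ (ex a b j : ℤ) := by
  rw [ex_cast a b h]; exact ex_ge' a b h j

/-- the theta series `∑_j (-1)^j X^(a j^2 + b j)` -/
noncomputable def th (a b : ℕ) : PS :=
  mk fun n => ∑ j ∈ Icc (-(n:ℤ)) n, if ex a b j = n then sg j else 0

theorem coeff_th (a b : ℕ) (h : b < a) (n M : ℕ) (hM : n ≤ M) :
    coeff n (th a b) = ∑ j ∈ Icc (-(M:ℤ)) M, if ex a b j = n then sg j else 0 := by
  rw [th, coeff_mk]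
  apply sum_subset
  · intro j hj; rw [mem_Icc] at *; omega
  · intro j _ hj
    rw [if_neg]
    rintro rfl
    apply hj
    have := abs_le.mp (ex_ge a b h j)
    rw [mem_Icc]; exact this

theorem th_spec (a b : ℕ) (h : b < a) (N : ℕ) :
    (X : PS)^N ∣ th a b - ∑ j ∈ Icc (-(N:ℤ)) N, C (sg j) * X^(ex a b j) := by
  rw [X_pow_dvd_iff]
  intro m hm
  rw [map_sub, coeff_th a b h m N hm.le, map_sum, sub_eq_zero]
  apply sum_congr rfl
  intro j _
  rw [coeff_C_mul_X_pow]
  simp only [eq_comm]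

theorem sg_sub (k N : ℕ) : sg ((k:ℤ) - N) = (-1)^k * (-1)^N := by
  unfold sg
  rw [← pow_add]
  have : Even ((k:ℤ) - N) ↔ Even (k+N) := by
    rw [Int.even_sub, Nat.even_add, Int.even_coe_nat, Int.even_coe_nat]
  by_cases hh : Even (k+N)
  · rw [if_pos (this.2 hh), hh.neg_one_pow]
  · rw [if_neg (fun h => hh (this.1 h)), (Nat.not_even_iff_odd.mp hh).neg_one_pow]

theorem prod_left (a b N c : ℕ) (h : b < a) (hc : c + b + a = 2 * a * N) :
    ∏ i ∈ range N, ((X : PS)^c + (-1) * (X^(2*a))^i) =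
      (-1)^N * X^(a*(N*(N-1))) * ∏ i ∈ range N, (1 - (X:PS)^(a*(2*i+1)-b)) := by
  have e1 : ∀ i ∈ range N, ((X : PS)^c + (-1) * (X^(2*a))^i) =
      (-1) * (X^(2*a))^i * (1 - X^(a*(2*(N-1-i)+1)-b)) := by
    intro i hi
    rw [mem_range] at hi
    obtain ⟨d, rfl⟩ : ∃ d, N = i + d + 1 := ⟨N - i - 1, by omega⟩
    have e : i + d + 1 - 1 - i = d := by omega
    rw [e]
    have hle : b ≤ a*(2*d+1) := by nlinarith
    have : c = 2*a*i + (a*(2*d+1)-b) := by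
      zify [hle]
      zify at hc
      linear_combination hc
    rw [← pow_mul, this, pow_add]
    ring
  rw [prod_congr rfl e1, prod_mul_distrib, prod_mul_distrib,
    prod_range_reflect (fun i => 1 - (X:PS)^(a*(2*i+1)-b)) N, prod_pow_eq_pow_sum]
  have := Finset.sum_range_id_mul_two N
  rw [← pow_mul, mul_assoc 2 a, mul_comm 2 (a * _), mul_assoc a, this]
  simp

theorem prod_right (a b N c : ℕ) (hc : c + b + a = 2 * a * N) :
    ∏ i ∈ range N, ((X : PS)^c + (-1) * (X^(2*a))^(N+i)) =
      X^(c*N) * ∏ i ∈ range N, (1 - (X:PS)^(a*(2*i+1)+b)) := by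
  have e1 : ∀ i ∈ range N, ((X : PS)^c + (-1) * (X^(2*a))^(N+i)) =
      X^c * (1 - X^(a*(2*i+1)+b)) := by
    intro i hi
    rw [← pow_mul, mul_add, ← hc]
    ring
  rw [prod_congr rfl e1, prod_mul_distrib]
  simp [pow_mul]

theorem jtp_fin (a b N : ℕ) (h : b < a) (hN : 0 < N) :
    (∏ i ∈ range N, (1 - (X:PS)^(a*(2*i+1)-b))) * (∏ i ∈ range N, (1 - (X:PS)^(a*(2*i+1)+b)))
    = ∑ p ∈ antidiagonal (2*N), C (sg ((p.1:ℤ) - N)) * X^(ex a b ((p.1:ℤ) - N))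
        * gb (X^(2*a)) (2*N) p.1 := by
  obtain ⟨c, hc⟩ : ∃ c, c + b + a = 2*a*N := ⟨2*a*N - b - a, by
    have : 2 * a ≤ 2*a*N := Nat.le_mul_of_pos_right _ hN
    omega⟩
  have key := qbinom (X^(2*a)) (X^c) (-1) (2*N)
  rw [two_mul N, prod_range_add, prod_left a b N c h hc, prod_right a b N c hc, ← two_mul] at key
  have hX : (X:PS)^(a*(N*(N-1)) + c*N) ≠ 0 := pow_ne_zero _ X_ne_zero
  apply mul_left_cancel₀ hX
  have s1 : ((-1:PS)^N) * (-1)^N = 1 := by rw [← mul_pow]; simp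
  have : ∀ p ∈ antidiagonal (2*N), (X:PS)^(a*(N*(N-1)) + c*N) *
      (C (sg ((p.1:ℤ) - N)) * X^(ex a b ((p.1:ℤ) - N)) * gb (X^(2*a)) (2*N) p.1)
      = (-1)^N * ((X ^ (2 * a)) ^ p.1.choose 2 * gb (X ^ (2 * a)) (2 * N) p.1 *
        (-1) ^ p.1 * (X ^ c) ^ p.2) := by
    rintro ⟨k, l⟩ hp
    rw [HasAntidiagonal.mem_antidiagonal] at hp
    simp only at hp ⊢
    rw [sg_sub]
    have ee : a*(N*(N-1)) + c*N + ex a b ((k:ℤ) - N) = 2*a*k.choose 2 + c*l := by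
      have h2 : 2 * (k.choose 2) = k*(k-1) := by
        rw [Nat.choose_two_right]; exact Nat.mul_div_cancel' (Nat.even_mul_pred_self k).two_dvd
      have h3 : ((k*(k-1) : ℕ):ℤ) = k*k - k := by
        cases k with
        | zero => simp
        | succ k => rw [Nat.add_sub_cancel]; push_cast; ring
      have h4 : ((N*(N-1) : ℕ):ℤ) = N*N - N := by
        cases N with
        | zero => simp
        | succ k => rw [Nat.add_sub_cancel]; push_cast; ring
      have h2' : (2:ℤ) * (k.choose 2) = k*k - k := by rw [← h3, ← h2]; push_cast; rfl
      have hp' : (l:ℤ) = 2*N - k := by omega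
      have hc' : (c:ℤ) = 2*a*N - a - b := by zify at hc; linear_combination hc
      zify
      rw [ex_cast a b h]
      push_cast at h4
      rw [h4, hp', hc']
      linear_combination (-(a:ℤ)) * h2'
    simp only [map_mul, map_pow, map_neg, map_one]
    rw [← pow_mul, ← pow_mul]
    calc _ = (-1)^k * (-1)^N * gb (X ^ (2 * a)) (2 * N) k * ((X:PS)^(a*(N*(N-1)) + c*N + ex a b ((k:ℤ) - N))) := by
            rw [pow_add _ _ (ex a b _)]; ring
      _ = _ := by rw [ee, pow_add]; ring
  rw [mul_sum, sum_congr rfl this, ← mul_sum, ← key, pow_add]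
  linear_combination (-(X:PS)^(a*(N*(N-1))) * X^(c*N) * (∏ i ∈ range N, (1 - (X:PS)^(a*(2*i+1)-b))) * (∏ i ∈ range N, (1 - (X:PS)^(a*(2*i+1)+b)))) * s1

/-- `f k = ∏ (1 - X^(k(i+1)))` -/
noncomputable def f (k : ℕ) : PS := iprod fun i => 1 - (X^k)^(i+1)

theorem f_spec (k : ℕ) (hk : 0 < k) (N : ℕ) :
    (X : PS)^N ∣ f k - ∏ i ∈ range N, (1 - (X^k)^(i+1)) := by
  apply iprod_spec
  intro i
  rw [← pow_mul]
  have : (1 - X^(k*(i+1)) - 1 : PS) = X^(k*(i+1)) * (-1) := by ring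
  rw [this]
  exact (pow_dvd_pow _ (Nat.le_mul_of_pos_left _ hk)).mul_right _

theorem f_unit (k : ℕ) (hk : 0 < k) : IsUnit (f k) := by
  rw [isUnit_iff_constantCoeff]
  have := (X_pow_dvd_iff.mp (f_spec k hk 1)) 0 (by omega)
  rw [map_sub, sub_eq_zero] at this
  rw [← coeff_zero_eq_constantCoeff_apply, this]
  simp [hk.ne']

theorem jtp (a b N : ℕ) (h : b < a) (hN : 0 < N) :
    (X:PS)^N ∣ f (2*a) * ((∏ i ∈ range N, (1 - (X:PS)^(a*(2*i+1)-b))) *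
      (∏ i ∈ range N, (1 - (X:PS)^(a*(2*i+1)+b)))) - th a b := by
  have h1 := th_spec a b h N
  have h2 : ∑ j ∈ Icc (-(N:ℤ)) N, C (sg j) * (X:PS)^(ex a b j) =
      ∑ p ∈ antidiagonal (2*N), C (sg ((p.1:ℤ) - N)) * X^(ex a b ((p.1:ℤ) - N)) := by
    symm
    refine sum_bij (fun p _ => (p.1:ℤ) - N) ?_ ?_ ?_ ?_
    · intro p hp; rw [HasAntidiagonal.mem_antidiagonal] at hp; rw [mem_Icc]; omega
    · rintro ⟨p1, p2⟩ hp ⟨q1, q2⟩ hq hh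
      rw [HasAntidiagonal.mem_antidiagonal] at hp hq
      simp only at hp hq hh
      rw [Prod.mk.injEq]; omega
    · intro j hj
      rw [mem_Icc] at hj
      refine ⟨((j+N).toNat, (N - j).toNat), ?_, ?_⟩
      · rw [HasAntidiagonal.mem_antidiagonal]; simp only; omega
      · simp only; omega
    · intros; rfl
  have h3 : (X:PS)^N ∣ f (2*a) * (∑ p ∈ antidiagonal (2*N), C (sg ((p.1:ℤ) - N)) *
      X^(ex a b ((p.1:ℤ) - N)) * gb (X^(2*a)) (2*N) p.1) -
      ∑ p ∈ antidiagonal (2*N), C (sg ((p.1:ℤ) - N)) * X^(ex a b ((p.1:ℤ) - N)) := by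
    rw [mul_sum, ← sum_sub_distrib]
    apply dvd_sum
    rintro ⟨k, l⟩ hp
    rw [HasAntidiagonal.mem_antidiagonal] at hp
    simp only at hp ⊢
    have g1 : (X:PS)^(min k l) ∣ f (2*a) * gb (X^(2*a)) (2*N) k - 1 := by
      have ha : 0 < 2*a := by omega
      have s1 := (pow_dvd_pow (X:PS) (min_le_left k l)).trans (f_spec (2*a) ha k)
      have s2 := (pow_dvd_pow (X:PS) (min_le_right k l)).trans (f_spec (2*a) ha l)
      have s3 := (pow_dvd_pow (X:PS) (show min k l ≤ 2*N by omega)).trans (f_spec (2*a) ha (2*N))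
      have s4 := gb_formula (X^(2*a)) (2*N) k l hp
      rw [← (f_unit (2*a) ha).dvd_mul_left]
      generalize (∏ i ∈ range k, (1 - ((X:PS)^(2*a))^(i+1))) = pk at *
      generalize (∏ i ∈ range l, (1 - ((X:PS)^(2*a))^(i+1))) = pl at *
      generalize (∏ i ∈ range (2*N), (1 - ((X:PS)^(2*a))^(i+1))) = pN at *
      have := dvd_sub (dvd_add (s1.mul_left (gb (X^(2*a)) (2*N) k * f (2*a)))
        (s2.mul_left (gb (X^(2*a)) (2*N) k * pk))) s3
      convert this using 1
      linear_combination s4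
    have g2 : (X:PS)^N ∣ X^(ex a b ((k:ℤ) - N)) * X^(min k l) := by
      rw [← pow_add]
      apply pow_dvd_pow
      have := ex_ge a b h ((k:ℤ) - N)
      rcases abs_cases ((k:ℤ) - N) with ⟨q1, q2⟩ | ⟨q1, q2⟩ <;> rw [q1] at this <;> omega
    have g3 := (g2.trans (mul_dvd_mul_left (X^(ex a b ((k:ℤ) - N))) g1)).mul_left (C (sg ((k:ℤ) - N)))
    convert g3 using 1
    ring
  rw [jtp_fin a b N h hN]
  rw [h2] at h1
  have := dvd_sub h3 h1
  convert this using 1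
  ring

end OddCol
namespace OddCol
open PowerSeries Finset

theorem three_zero : (3 : PS) = 0 := by
  have : (C (3 : ZMod 3) : PS) = 0 := by
    rw [show (3 : ZMod 3) = 0 from rfl, map_zero]
  rwa [show (C (3:ZMod 3) : PS) = 3 from map_ofNat _ 3] at this

theorem expand_eq (P : PS) : PowerSeries.expand 3 (by norm_num) P = P^3 := by
  have h := MvPowerSeries.map_frobenius_expand (σ := Unit) (R := ZMod 3) 3 (by norm_num) (f := P)
  rw [ZMod.frobenius_zmod] at h
  rw [MvPowerSeries.map_id] at h
  exact h

theorem coeff_cube (P : PS) (n : ℕ) : coeff n (P^3) = if 3 ∣ n then coeff (n/3) P else 0 := by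
  rw [← expand_eq, coeff_expand]

theorem dec0 (P Q R : PS) (n : ℕ) : coeff (3*n) (P^3 + X * Q^3 + X^2 * R^3) = coeff n P := by
  have e : (X : PS) * Q^3 = X^1 * Q^3 := by ring
  rw [e, map_add, map_add, coeff_X_pow_mul', coeff_X_pow_mul', coeff_cube, coeff_cube, coeff_cube]
  rw [if_pos (by omega)]
  have h2 : (if 2 ≤ 3*n then if 3 ∣ 3*n-2 then coeff ((3*n-2)/3) R else 0 else 0) = 0 := by
    split_ifs
    · omega
    · rfl
    · rfl
  rw [h2]
  have : (if 1 ≤ 3*n then if 3 ∣ 3*n-1 then coeff ((3*n-1)/3) Q else 0 else 0) = 0 := by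
    split_ifs
    · omega
    · rfl
    · rfl
  rw [this]
  simp

theorem dec1 (P Q R : PS) (n : ℕ) : coeff (3*n+1) (P^3 + X * Q^3 + X^2 * R^3) = coeff n Q := by
  have e : (X : PS) * Q^3 = X^1 * Q^3 := by ring
  rw [e, map_add, map_add, coeff_X_pow_mul', coeff_X_pow_mul', coeff_cube, coeff_cube, coeff_cube]
  rw [if_neg (show ¬ 3 ∣ 3*n+1 by omega), if_pos (show 1 ≤ 3*n+1 by omega),
    if_pos (show 3 ∣ 3*n+1-1 by omega)]
  have : (if 2 ≤ 3*n+1 then if 3 ∣ 3*n+1-2 then coeff ((3*n+1-2)/3) R else 0 else 0) = 0 := by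
    split_ifs
    · omega
    · rfl
    · rfl
  rw [this]
  simp

theorem dec2 (P Q R : PS) (n : ℕ) : coeff (3*n+2) (P^3 + X * Q^3 + X^2 * R^3) = coeff n R := by
  have e : (X : PS) * Q^3 = X^1 * Q^3 := by ring
  rw [e, map_add, map_add, coeff_X_pow_mul', coeff_X_pow_mul', coeff_cube, coeff_cube, coeff_cube]
  rw [if_neg (show ¬ 3 ∣ 3*n+2 by omega), if_pos (show 1 ≤ 3*n+2 by omega),
    if_neg (show ¬ 3 ∣ 3*n+2-1 by omega), if_pos (show 2 ≤ 3*n+2 by omega),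
    if_pos (show 3 ∣ 3*n+2-2 by omega)]
  simp

/-- index set of the theta coefficient -/
noncomputable def Fb (a b n : ℕ) : Finset ℤ := (Icc (-(n:ℤ)) n).filter fun j => ex a b j = n

theorem mem_Fb (a b n : ℕ) (h : b < a) (j : ℤ) : j ∈ Fb a b n ↔ (a:ℤ) * j^2 + b * j = n := by
  rw [Fb, mem_filter, mem_Icc, ← ex_cast a b h]
  constructor
  · rintro ⟨_, h⟩; rw [h]
  · intro hh
    have := abs_le.mp (ex_ge a b h j)
    refine ⟨?_, by exact_mod_cast hh⟩
    rw [← hh]; exact this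

theorem coeff_th_Fb (a b n : ℕ) : coeff n (th a b) = ∑ j ∈ Fb a b n, sg j := by
  rw [th, coeff_mk, Fb, sum_filter]

theorem sg_three (i : ℤ) : sg (3*i) = sg i := by
  unfold sg
  have : Even (3*i) ↔ Even i := by
    rw [Int.even_mul]; constructor
    · rintro (h | h)
      · exact absurd h (by decide)
      · exact h
    · exact Or.inr
  simp only [this]

theorem sg_succ (i : ℤ) : sg (i+1) = - sg i := by
  unfold sg
  have : Even (i+1) ↔ ¬ Even i := by rw [Int.even_add_one]
  by_cases h : Even i <;> simp [this, h]

theorem sg_neg (i : ℤ) : sg (-i) = sg i := by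
  unfold sg; simp only [even_neg]

theorem cA0 (u : ℕ) : coeff (3*(3*u)) (th 1 0) = coeff u (th 1 0) := by
  rw [coeff_th_Fb, coeff_th_Fb]
  symm
  refine sum_nbij' (fun i => 3*i) (fun j => j/3) ?_ ?_ ?_ ?_ ?_
  · intro i hi
    rw [mem_Fb _ _ _ (by norm_num)] at *
    push_cast at *
    linear_combination 9*hi
  · intro j hj
    rw [mem_Fb _ _ _ (by norm_num)] at *
    push_cast at *
    have h3 : (3:ℤ) ∣ j := by
      apply Int.prime_three.dvd_of_dvd_pow (n := 2)
      exact ⟨3*u, by linear_combination hj⟩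
    obtain ⟨i, rfl⟩ := h3
    rw [Int.mul_ediv_cancel_left _ (by norm_num)]
    nlinarith
  · intro i _; simp
  · intro j hj
    rw [mem_Fb _ _ _ (by norm_num)] at *
    push_cast at *
    have h3 : (3:ℤ) ∣ j := by
      apply Int.prime_three.dvd_of_dvd_pow (n := 2)
      exact ⟨3*u, by linear_combination hj⟩
    omega
  · intro i _; rw [sg_three]

theorem cA0' (m : ℕ) (hm : ¬ 3 ∣ m) : coeff (3*m) (th 1 0) = 0 := by
  rw [coeff_th_Fb]
  apply sum_eq_zero
  intro j hj
  exfalso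
  rw [mem_Fb _ _ _ (by norm_num)] at hj
  push_cast at hj
  have h3 : (3:ℤ) ∣ j := by
    apply Int.prime_three.dvd_of_dvd_pow (n := 2)
    exact ⟨m, by linear_combination hj⟩
  obtain ⟨i, rfl⟩ := h3
  apply hm
  have : (m:ℤ) = 3 * i^2 := by linarith
  omega

theorem cA2 (m : ℕ) : coeff (3*m+2) (th 1 0) = 0 := by
  rw [coeff_th_Fb]
  apply sum_eq_zero
  intro j hj
  exfalso
  rw [mem_Fb _ _ _ (by norm_num)] at hj
  push_cast at hj
  have h : j * j = 3*m+2 := by linarith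
  have h1 : j % 3 = 0 ∨ j % 3 = 1 ∨ j % 3 = 2 := by omega
  have h2 := Int.mul_emod j j 3
  rcases h1 with h1 | h1 | h1 <;> rw [h1, h] at h2 <;> omega

theorem cA1 (m : ℕ) : coeff (3*m+1) (th 1 0) = coeff m (th 3 2) := by
  rw [coeff_th_Fb, coeff_th_Fb, ← sum_filter_add_sum_filter_not _ (fun j => j % 3 = 1)]
  have e1 : ∑ j ∈ (Fb 1 0 (3*m+1)).filter (fun j => j % 3 = 1), sg j = - ∑ i ∈ Fb 3 2 m, sg i := by
    rw [← sum_neg_distrib]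
    symm
    refine sum_nbij' (fun i => 3*i+1) (fun j => j/3) ?_ ?_ ?_ ?_ ?_
    · intro i hi
      rw [mem_filter]
      rw [mem_Fb _ _ _ (by norm_num)] at *
      push_cast at *
      exact ⟨by linear_combination 3*hi, by omega⟩
    · intro j hj
      rw [mem_filter] at hj
      rw [mem_Fb _ _ _ (by norm_num)] at *
      push_cast at *
      obtain ⟨h1, h2⟩ := hj
      obtain ⟨i, rfl⟩ : ∃ i, j = 3*i+1 := ⟨j/3, by omega⟩
      rw [show (3*i+1)/3 = i by omega]
      nlinarith
    · intro i _; omega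
    · intro j hj
      rw [mem_filter] at hj
      omega
    · intro i _; rw [sg_succ, sg_three]
  have e2 : ∑ j ∈ (Fb 1 0 (3*m+1)).filter (fun j => ¬ j % 3 = 1), sg j = - ∑ i ∈ Fb 3 2 m, sg i := by
    rw [← sum_neg_distrib]
    symm
    have aux : ∀ j : ℤ, j^2 = 3*m+1 → ¬ j % 3 = 1 → j % 3 = 2 := by
      intro j h hn
      have h' : j * j = 3*m+1 := by linarith
      have h2 := Int.mul_emod j j 3
      by_contra hc
      have : j % 3 = 0 := by omega
      rw [this, h'] at h2
      omega
    refine sum_nbij' (fun i => -(3*i+1)) (fun j => (-j)/3) ?_ ?_ ?_ ?_ ?_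
    · intro i hi
      rw [mem_filter]
      rw [mem_Fb _ _ _ (by norm_num)] at *
      push_cast at *
      exact ⟨by linear_combination 3*hi, by omega⟩
    · intro j hj
      rw [mem_filter] at hj
      rw [mem_Fb _ _ _ (by norm_num)] at *
      push_cast at *
      obtain ⟨h1, h2⟩ := hj
      have h3 := aux j (by linarith) h2
      obtain ⟨i, rfl⟩ : ∃ i, j = -(3*i+1) := ⟨(-j)/3, by omega⟩
      rw [show (-(-(3*i+1)))/3 = i by omega]
      nlinarith
    · intro i _; omega
    · intro j hj
      rw [mem_filter] at hj
      rw [mem_Fb _ _ _ (by norm_num)] at hj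
      push_cast at hj
      obtain ⟨h1, h2⟩ := hj
      have h3 := aux j (by linarith) h2
      omega
    · intro i _; rw [sg_neg, sg_succ, sg_three]
  rw [e1, e2]
  generalize ∑ i ∈ Fb 3 2 m, sg i = z
  revert z; decide

theorem A_dec : th 1 0 = ((th 1 0)^3)^3 + X * (th 3 2)^3 + X^2 * (0:PS)^3 := by
  ext n
  obtain ⟨m, h⟩ : ∃ m, n = 3*m ∨ n = 3*m+1 ∨ n = 3*m+2 := ⟨n/3, by omega⟩
  rcases h with rfl | rfl | rfl
  · rw [dec0, coeff_cube]
    split_ifs with h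
    · obtain ⟨u, rfl⟩ := h
      rw [cA0]; simp
    · exact cA0' m h
  · rw [dec1, cA1]
  · rw [dec2, cA2]; simp

noncomputable def O : PS := iprod fun i => 1 - X^(2*i+1)

theorem O_spec (N : ℕ) : (X : PS)^N ∣ O - ∏ i ∈ range N, (1 - X^(2*i+1)) := by
  apply iprod_spec
  intro i
  have : (1 - X^(2*i+1) - 1 : PS) = X^(2*i+1) * (-1) := by ring
  rw [this]
  exact (pow_dvd_pow _ (by omega)).mul_right _

theorem O_unit : IsUnit O := by
  rw [isUnit_iff_constantCoeff]
  have := (X_pow_dvd_iff.mp (O_spec 1)) 0 (by omega)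
  rw [map_sub, sub_eq_zero] at this
  rw [← coeff_zero_eq_constantCoeff_apply, this]
  simp

theorem cube_sub (Y : PS) : (1 - Y)^3 = 1 - Y^3 := by
  linear_combination (Y^2 - Y) * three_zero

theorem f_six : f 6 = (f 2)^3 := by
  apply ps_eq
  intro N
  have h1 := f_spec 6 (by norm_num) N
  have h2 := f_spec 2 (by norm_num) N
  have e : ∏ i ∈ range N, (1 - ((X:PS)^6)^(i+1)) = (∏ i ∈ range N, (1 - ((X:PS)^2)^(i+1)))^3 := by
    rw [← prod_pow]
    apply prod_congr rfl
    intro i _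
    rw [cube_sub]; ring
  rw [e] at h1
  have h3 := h2.trans (sub_dvd_pow_sub_pow _ _ 3)
  have := dvd_sub h1 h3
  convert this using 1
  ring

theorem A_prod : th 1 0 = f 2 * O^2 := by
  apply ps_eq
  intro N
  rcases Nat.eq_zero_or_pos N with rfl | hN
  · simp
  have h1 := jtp 1 0 N (by norm_num) hN
  simp only [one_mul, mul_one, Nat.sub_zero, Nat.add_zero] at h1
  have h2 := ((O_spec N).trans (sub_dvd_pow_sub_pow _ _ 2)).mul_left (f 2)
  rw [dvd_sub_comm]
  have := dvd_add h2 h1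
  convert this using 1
  ring

theorem O_split (N : ℕ) : (∏ i ∈ range N, (1 - (X:PS)^(3*(2*i+1)-2))) *
    (∏ i ∈ range N, (1 - (X:PS)^(3*(2*i+1)+2))) * (∏ i ∈ range N, (1 - (X:PS)^(2*i+1)))^3
    = ∏ i ∈ range (3*N), (1 - (X:PS)^(2*i+1)) := by
  induction N with
  | zero => simp
  | succ N ih =>
    rw [show 3*(N+1) = 3*N+1+1+1 by ring]
    simp only [prod_range_succ]
    rw [← ih, mul_pow, cube_sub, ← pow_mul]
    rw [show 3*(2*N+1)-2 = 2*(3*N)+1 by omega, show 3*(2*N+1)+2 = 2*(3*N+1+1)+1 by omega,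
      show (2*N+1)*3 = 2*(3*N+1)+1 by omega]
    ring

theorem Om_prod : th 3 2 * O^3 = (f 2)^3 * O := by
  apply ps_eq
  intro N
  rcases Nat.eq_zero_or_pos N with rfl | hN
  · simp
  have h1 := jtp 3 2 N (by norm_num) hN
  rw [show 2*3 = 6 from rfl, f_six] at h1
  have h2 := ((O_spec N).trans (sub_dvd_pow_sub_pow _ _ 3)).mul_left (th 3 2)
  have h3 := ((pow_dvd_pow (X:PS) (show N ≤ 3*N by omega)).trans (O_spec (3*N))).mul_left (f 2 ^ 3)
  rw [← O_split N] at h3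
  have h4 := h1.mul_right ((∏ i ∈ range N, (1 - (X:PS)^(2*i+1)))^3)
  have := dvd_sub (dvd_sub h2 h4) h3
  convert this using 1
  ring

theorem Om_eq (G : PS) (hG : O * G = 1) : th 3 2 = (th 1 0)^3 * G^8 := by
  have h := Om_prod
  rw [A_prod]
  have h3 : O^3 * G^3 = 1 := by rw [← mul_pow, hG, one_pow]
  have h6 : O^6 * G^6 = 1 := by rw [← mul_pow, hG, one_pow]
  linear_combination (-th 3 2) * h3 + G^3 * h + f 2^3 * G^2 * hG - f 2^3 * G^2 * h6

theorem step (G : PS) (hG : O * G = 1) (P : PS) (m r : ℕ) (hr : r ≤ 2) :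
    coeff (3*m+r) (P^3 * (th 1 0)^2) = (Nat.choose 2 r : ZMod 3) * coeff m (P * (th 1 0)^6 * G^(8*r)) := by
  have hA := A_dec
  rw [Om_eq G hG] at hA
  set A := th 1 0
  have e : P^3 * A^2 = (P * A^6)^3 + X * (2 * P * A^6 * G^8)^3 + X^2 * (P * A^6 * G^16)^3 := by
    have : P^3 * A^2 = P^3 * (((A)^3)^3 + X * (A^3*G^8)^3 + X^2 * (0:PS)^3)^2 := by rw [← hA]
    rw [this]
    linear_combination (-2*(X * (P * A^6 * G^8)^3)) * three_zero
  rw [e]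
  interval_cases r
  · rw [add_zero, dec0]; simp
  · rw [dec1]
    have : 2 * P * A^6 * G^8 = C 2 * (P * A^6 * G^8) := by
      rw [show (C (2:ZMod 3) : PS) = 2 from map_ofNat _ 2]; ring
    rw [this, coeff_C_mul]; simp
  · rw [dec2]; simp

theorem step' (P : PS) (m : ℕ) : coeff (3*m+2) (P^3 * th 1 0) = 0 := by
  have e : P^3 * th 1 0 = (P * (th 1 0)^3)^3 + X * (P * th 3 2)^3 + X^2 * (0:PS)^3 := by
    conv_lhs => rw [A_dec]
    ring
  rw [e, dec2]; simp

theorem main (Y : PS) (j t n : ℕ) (ht : t ≤ 8) (hY : f 2 * O^(27*j+3*t+2) * Y = 1) :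
    coeff (27*n+18+t) Y = 0 := by
  obtain ⟨G, hG⟩ := O_unit.exists_right_inv
  have hA := A_prod
  set A := th 1 0
  have hP : ∀ k, O^k * G^k = 1 := fun k => by rw [← mul_pow, hG, one_pow]
  obtain ⟨I, hI⟩ : ∃ I : PS, A * I = 1 := ⟨O^(27*j+3*t) * Y, by rw [hA, ← hY]; ring⟩
  have hY' : Y = (I * G^(9*j+t))^3 * A^2 := by
    have h1 : Y = I * G^(27*j+3*t) := by
      have h2 : A * O^(27*j+3*t) * Y = 1 := by rw [hA, ← hY]; ring
      linear_combination (-Y) * hI - (A * I * Y) * hP (27*j+3*t) + I * G^(27*j+3*t) * h2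
    rw [h1, mul_pow, ← pow_mul, show (9*j+t)*3 = 27*j+3*t by ring]
    linear_combination (-I * G^(27*j+3*t)) * (A*I+1) * hI
  obtain ⟨s, r, hr, rfl⟩ : ∃ s r, r ≤ 2 ∧ t = 3*s+r := ⟨t/3, t%3, by omega, by omega⟩
  have hs : s ≤ 2 := by omega
  rw [hY', show 27*n+18+(3*s+r) = 3*(9*n+6+s)+r by ring, step G hG _ _ _ hr]
  have e1 : I * G^(9*j+(3*s+r)) * A^6 * G^(8*r) = (G^(3*j+s+3*r) * A)^3 * A^2 := by
    rw [mul_pow, ← pow_mul, show (3*j+s+3*r)*3 = 9*j+(3*s+r) + 8*r by ring, pow_add _ _ (8*r)]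
    linear_combination (G^(9*j+(3*s+r)) * G^(8*r) * A^5) * hI
  rw [e1, show 9*n+6+s = 3*(3*n+2)+s by ring, step G hG _ _ _ hs]
  have e2 : G^(3*j+s+3*r) * A * A^6 * G^(8*s) = (G^(j+r+3*s) * A^2)^3 * A := by
    rw [mul_pow, ← pow_mul, show (j+r+3*s)*3 = 3*j+s+3*r + 8*s by ring, pow_add _ _ (8*s)]
    ring
  rw [e2, step']
  simp

end OddCol
namespace OddCol
open PowerSeries Finset

/-- admissible coloured parts of size at most `2 * M` -/
def S (k M : ℕ) : Finset (ℕ × ℕ) :=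
  ((Finset.Icc 1 (2*M)) ×ˢ (Finset.Icc 1 k)).filter fun p => Even p.1 → p.2 = 1

theorem mem_S (k M : ℕ) (p : ℕ × ℕ) : p ∈ S k M ↔
    (1 ≤ p.1 ∧ p.1 ≤ 2*M) ∧ (1 ≤ p.2 ∧ p.2 ≤ k) ∧ (Even p.1 → p.2 = 1) := by
  simp [S, and_assoc]

/-- geometric series `1/(1 - X^m)` -/
noncomputable def geo (m : ℕ) : PS := mk fun n => if m ∣ n then 1 else 0

theorem geo_mul (m : ℕ) (hm : 0 < m) : (1 - X^m) * geo m = 1 := by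
  ext n
  rw [sub_mul, one_mul, map_sub, coeff_X_pow_mul', geo, coeff_mk, coeff_one]
  by_cases h : m ≤ n
  · rw [if_pos h, coeff_mk, if_neg (show ¬ n = 0 by omega)]
    simp only [Nat.dvd_sub_iff_left h dvd_rfl, sub_self]
  · rw [if_neg h, sub_zero]
    by_cases h0 : n = 0
    · simp [h0]
    · rw [if_neg h0, if_neg]
      intro hd
      exact h (Nat.le_of_dvd (by omega) hd)

theorem card_bij_F (k n M : ℕ) (hM : n ≤ 2*M) (F : Finset ((ℕ × ℕ) →₀ ℕ))
    (hF : ∀ l : (ℕ × ℕ) →₀ ℕ, l ∈ F ↔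
      ((S k M).sum l = n ∧ l.support ⊆ S k M) ∧ ∀ i ∈ S k M, i.1 ∣ l i) :
    a k n = F.card := by
  rw [a, ← Nat.card_eq_finsetCard]
  have hsum : ∀ s : Multiset (ℕ × ℕ), (∀ p ∈ s, p ∈ S k M) →
      (s.map Prod.fst).sum = ∑ p ∈ S k M, p.1 * s.count p := by
    intro s hs
    rw [Finset.sum_multiset_map_count]
    simp only [smul_eq_mul, mul_comm]
    apply sum_subset
    · intro p hp; exact hs p (Multiset.mem_toFinset.mp hp)
    · intro p _ hp
      rw [Multiset.mem_toFinset] at hp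
      rw [Multiset.count_eq_zero_of_notMem hp, mul_zero]
  have hS : ∀ s ∈ coloredOddPartitions k n, ∀ p ∈ s, p ∈ S k M := by
    rintro s ⟨hs, hn⟩ p hp
    rw [mem_S]
    obtain ⟨q1, q2, q3, q4⟩ := hs p hp
    have : p.1 ≤ (s.map Prod.fst).sum := Multiset.le_sum_of_mem (Multiset.mem_map_of_mem _ hp)
    exact ⟨⟨q1, by omega⟩, ⟨q2, q3⟩, q4⟩
  refine Nat.card_eq_of_bijective
    (fun s : coloredOddPartitions k n =>
      (⟨Finsupp.onFinset (S k M) (fun p => p.1 * s.1.count p) ?_, ?_⟩ :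
        {l // l ∈ F})) ⟨?_, ?_⟩
  · intro p hp
    apply hS s.1 s.2
    rw [← Multiset.count_ne_zero]
    exact right_ne_zero_of_mul hp
  · rw [hF]
    refine ⟨⟨?_, Finsupp.support_onFinset_subset⟩, ?_⟩
    · exact (hsum s.1 (hS s.1 s.2)).symm.trans s.2.2
    · intro i _
      exact dvd_mul_right _ _
  · rintro ⟨s, hs⟩ ⟨s', hs'⟩ h
    rw [Subtype.mk.injEq] at h
    rw [Subtype.mk.injEq]
    ext p
    have := DFunLike.congr_fun h p
    simp only [Finsupp.onFinset_apply] at this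
    by_cases hp : p.1 = 0
    · rw [Multiset.count_eq_zero_of_notMem, Multiset.count_eq_zero_of_notMem]
      · intro h'; have := (hs'.1 p h').1; omega
      · intro h'; have := (hs.1 p h').1; omega
    · exact Nat.eq_of_mul_eq_mul_left (by omega) this
  · rintro ⟨l, hl⟩
    have hl' := hl
    rw [hF] at hl'
    obtain ⟨⟨hl1, hl2⟩, hl3⟩ := hl'
    let g : (ℕ × ℕ) →₀ ℕ := Finsupp.onFinset (S k M) (fun p => l p / p.1) (by
      intro p hp
      apply hl2
      rw [Finsupp.mem_support_iff]
      intro h0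
      rw [h0] at hp
      simp at hp)
    have hc : ∀ p, (Finsupp.toMultiset g).count p = l p / p.1 := by
      intro p; rw [Finsupp.count_toMultiset]; rfl
    have hlS : ∀ p, p ∉ S k M → l p = 0 := by
      intro p hp
      by_contra h
      exact hp (hl2 (Finsupp.mem_support_iff.mpr h))
    have hm : ∀ p ∈ Finsupp.toMultiset g, p ∈ S k M := by
      intro p hp
      by_contra h
      rw [← Multiset.count_ne_zero, hc, hlS p h] at hp
      simp at hp
    have hmul : ∀ p, p.1 * (l p / p.1) = l p := by
      intro p
      by_cases hp : p ∈ S k M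
      · exact Nat.mul_div_cancel' (hl3 p hp)
      · simp [hlS p hp]
    refine ⟨⟨Finsupp.toMultiset g, ?_, ?_⟩, ?_⟩
    · intro p hp
      obtain ⟨⟨q1, _⟩, ⟨q2, q3⟩, q4⟩ := (mem_S k M p).mp (hm p hp)
      exact ⟨q1, q2, q3, q4⟩
    · rw [hsum _ hm, ← hl1]
      apply sum_congr rfl
      intro p _
      rw [hc, hmul]
    · rw [Subtype.mk.injEq]
      ext p
      rw [Finsupp.onFinset_apply]
      simp only [hc, hmul]

theorem card_eq (k n M : ℕ) (hM : n ≤ 2*M) :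
    (a k n : ZMod 3) = coeff n (∏ p ∈ S k M, geo p.1) := by
  rw [coeff_prod]
  have h1 : ∀ l ∈ finsuppAntidiag (S k M) n, ∏ i ∈ S k M, coeff (l i) (geo i.1) =
      if (∀ i ∈ S k M, i.1 ∣ l i) then (1 : ZMod 3) else 0 := by
    intro l _
    simp only [geo, coeff_mk]
    by_cases h : ∀ i ∈ S k M, i.1 ∣ l i
    · rw [if_pos h]
      exact prod_eq_one fun i hi => if_pos (h i hi)
    · rw [if_neg h]
      push Not at h
      obtain ⟨i, hi, hd⟩ := h
      exact prod_eq_zero hi (if_neg hd)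
  rw [sum_congr rfl h1, sum_boole]
  congr 1
  apply card_bij_F k n M hM
  intro l
  rw [mem_filter, mem_finsuppAntidiag]

theorem prod_S (k M : ℕ) (hk : 1 ≤ k) : ∏ p ∈ S k M, (1 - (X:PS)^p.1) =
    (∏ i ∈ range M, (1 - ((X:PS)^2)^(i+1))) * (∏ i ∈ range M, (1 - (X:PS)^(2*i+1)))^k := by
  have h1 : ∏ p ∈ S k M, (1 - (X:PS)^p.1) =
      ∏ m ∈ Finset.Icc 1 (2*M), (1 - (X:PS)^m)^(if Even m then 1 else k) := by
    rw [S, prod_filter, prod_product]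
    apply prod_congr rfl
    intro m _
    simp only
    by_cases h : Even m
    · simp only [h, true_imp_iff, if_true, pow_one]
      rw [prod_ite_eq' (Finset.Icc 1 k) 1, if_pos (by rw [Finset.mem_Icc]; omega)]
    · simp [h]
  rw [h1]
  clear h1
  induction M with
  | zero => simp
  | succ M ih =>
    rw [show 2*(M+1) = 2*M+1+1 by ring, prod_Icc_succ_top (by omega), prod_Icc_succ_top (by omega), ih,
      prod_range_succ, prod_range_succ, if_neg (show ¬ Even (2*M+1) by rw [Nat.even_iff]; omega),
      if_pos (show Even (2*M+1+1) by rw [Nat.even_iff]; omega), mul_pow _ _ k, ← pow_mul]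
    ring

theorem final (j t n : ℕ) (ht : t ≤ 8) : (a (27*j+3*t+2) (27*n+18+t) : ZMod 3) = 0 := by
  set k := 27*j+3*t+2 with hk
  set m := 27*n+18+t with hm
  have hu : IsUnit (f 2 * O^k) := (f_unit 2 (by norm_num)).mul (O_unit.pow k)
  obtain ⟨Y, hY⟩ := hu.exists_right_inv
  have hc := main Y j t n ht hY
  rw [card_eq k m (m+1) (by omega)]
  have h1 : (∏ p ∈ S k (m+1), (1 - (X:PS)^p.1)) * ∏ p ∈ S k (m+1), geo p.1 = 1 := by
    rw [← prod_mul_distrib]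
    apply prod_eq_one
    intro p hp
    exact geo_mul _ ((mem_S _ _ _).mp hp).1.1
  rw [prod_S k (m+1) (by omega)] at h1
  have s1 := f_spec 2 (by norm_num) (m+1)
  have s2 := (O_spec (m+1)).trans (sub_dvd_pow_sub_pow _ _ k)
  generalize (∏ i ∈ range (m+1), (1 - ((X:PS)^2)^(i+1))) = p1 at *
  generalize (∏ i ∈ range (m+1), (1 - (X:PS)^(2*i+1))) = p2 at *
  generalize (∏ p ∈ S k (m+1), geo p.1) = Z at *
  have h2 : (X:PS)^(m+1) ∣ Z - Y := by
    have := (dvd_add (s1.mul_right (O^k)) (s2.mul_left p1)).mul_left (Z*Y)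
    convert this using 1
    linear_combination Y * h1 - Z * hY
  have h3 := (X_pow_dvd_iff.mp h2) m (by omega)
  rw [map_sub, hc, sub_zero] at h3
  exact h3

end OddCol

theorem stmt7 (j t n : ℕ) (ht : t ≤ 8) :
    a (27 * j + 3 * t + 2) (27 * n + 18 + t) ≡ 0 [MOD 3] := by
  rw [← ZMod.natCast_eq_natCast_iff, Nat.cast_zero]
  exact OddCol.final j t n ht
end
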